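/- (Oscillation decay) There exists a universal constant μ ∈ (0,1), depending only on n, Λ, M and C₀, such that every bounded viscosity solution η ≥ 0 of the linearized oblique problem on K₁⁺ satisfies osc over K⁺_{1/2} of η ≤ (1−μ)·(osc over K₁⁺ of η), where osc_E η := sup_E η − inf_E η. -/

import Mathlib

open Set MeasureTheory Metric
open scoped RealInnerProductSpace

noncomputable section

abbrev Eucl (n : ℕ) : Type := EuclideanSpace ℝ (Fin n)
abbrev SpaceTime (n : ℕ) : Type := Eucl n × ℝ

/-- The operator norm of an `n × n` real matrix, acting on Euclidean space. -/
noncomputable def matOpNorm {n : ℕ} (A : Matrix (Fin n) (Fin n) ℝ) : ℝ :=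
  ‖(LinearMap.toContinuousLinearMap (Matrix.toEuclideanLin A))‖

/-- `F` is uniformly elliptic with ellipticity constant `Λ`. -/
def UniformlyElliptic {n : ℕ} (Λ : ℝ) (F : Matrix (Fin n) (Fin n) ℝ → ℝ) : Prop :=
  ∀ M N : Matrix (Fin n) (Fin n) ℝ, M.IsSymm → N.IsSymm → N.PosSemidef →
    Λ⁻¹ * matOpNorm N ≤ F (M + N) - F M ∧ F (M + N) - F M ≤ Λ * matOpNorm N

/-- Pucci minimal operator `P⁻(R, a, b) = a ∑_{eᵢ>0} eᵢ + b ∑_{eᵢ<0} eᵢ`. -/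
noncomputable def pucciMinus {n : ℕ} (R : Matrix (Fin n) (Fin n) ℝ) (a b : ℝ) : ℝ :=
  if h : R.IsHermitian then
    a * ∑ i, max (h.eigenvalues i) 0 + b * ∑ i, min (h.eigenvalues i) 0
  else 0

/-- Pucci maximal operator `P⁺(R, a, b) = a ∑_{eᵢ<0} eᵢ + b ∑_{eᵢ>0} eᵢ`. -/
noncomputable def pucciPlus {n : ℕ} (R : Matrix (Fin n) (Fin n) ℝ) (a b : ℝ) : ℝ :=
  if h : R.IsHermitian then
    a * ∑ i, min (h.eigenvalues i) 0 + b * ∑ i, max (h.eigenvalues i) 0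
  else 0

/-- Parabolic cylinder `E_ρ(x₀,t₀) = B_ρ(x₀) × (t₀ − ρ², t₀]`. -/
def cylE {n : ℕ} (x₀ : Eucl n) (t₀ ρ : ℝ) : Set (SpaceTime n) :=
  (ball x₀ ρ) ×ˢ (Ioc (t₀ - ρ ^ 2) t₀)

/-- `φ` is C² in `x` and C¹ in `t` on `D`, with time derivative `φt`,
spatial gradient `gφ` and spatial Hessian `Hφ`. -/
structure ParabolicTest {n : ℕ} (φ : SpaceTime n → ℝ) (D : Set (SpaceTime n))
    (φt : SpaceTime n → ℝ) (gφ : SpaceTime n → Eucl n)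
    (Hφ : SpaceTime n → Matrix (Fin n) (Fin n) ℝ) : Prop where
  contPhi : ContinuousOn φ D
  contPhit : ContinuousOn φt D
  contGrad : ContinuousOn gφ D
  contHess : ContinuousOn Hφ D
  symmHess : ∀ p ∈ D, (Hφ p).IsSymm
  timeDeriv : ∀ p ∈ D, HasDerivWithinAt (fun s : ℝ => φ (p.1, s)) (φt p) {s : ℝ | (p.1, s) ∈ D} p.2
  spaceGrad : ∀ p ∈ D, HasGradientWithinAt (fun y => φ (y, p.2)) (gφ p) {y | (y, p.2) ∈ D} p.1
  spaceHess : ∀ p ∈ D, HasFDerivWithinAt (fun y => gφ (y, p.2))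
      (LinearMap.toContinuousLinearMap (Matrix.toEuclideanLin (Hφ p))) {y | (y, p.2) ∈ D} p.1

/-- `φ` touches `u` from above at `p₀` in the set `E`. -/
def TouchesAbove {n : ℕ} (φ u : SpaceTime n → ℝ) (E : Set (SpaceTime n)) (p₀ : SpaceTime n) :
    Prop :=
  p₀ ∈ E ∧ φ p₀ = u p₀ ∧ ∀ p ∈ E, u p ≤ φ p

/-- `φ` touches `u` from below at `p₀` in the set `E`. -/
def TouchesBelow {n : ℕ} (φ u : SpaceTime n → ℝ) (E : Set (SpaceTime n)) (p₀ : SpaceTime n) :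
    Prop :=
  p₀ ∈ E ∧ φ p₀ = u p₀ ∧ ∀ p ∈ E, φ p ≤ u p

/-- `u` is a viscosity subsolution of `u_t = F(D²u)` in `D`. -/
def ViscSub {n : ℕ} (F : Matrix (Fin n) (Fin n) ℝ → ℝ) (u : SpaceTime n → ℝ)
    (D : Set (SpaceTime n)) : Prop :=
  ∀ (φ φt : SpaceTime n → ℝ) (gφ : SpaceTime n → Eucl n)
    (Hφ : SpaceTime n → Matrix (Fin n) (Fin n) ℝ) (p₀ : SpaceTime n) (ρ : ℝ),
    0 < ρ → p₀ ∈ D → cylE p₀.1 p₀.2 ρ ⊆ D →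
    ParabolicTest φ (cylE p₀.1 p₀.2 ρ) φt gφ Hφ →
    TouchesAbove φ u (cylE p₀.1 p₀.2 ρ) p₀ →
    φt p₀ ≤ F (Hφ p₀)

/-- `u` is a viscosity supersolution of `u_t = F(D²u)` in `D`. -/
def ViscSup {n : ℕ} (F : Matrix (Fin n) (Fin n) ℝ → ℝ) (u : SpaceTime n → ℝ)
    (D : Set (SpaceTime n)) : Prop :=
  ∀ (φ φt : SpaceTime n → ℝ) (gφ : SpaceTime n → Eucl n)
    (Hφ : SpaceTime n → Matrix (Fin n) (Fin n) ℝ) (p₀ : SpaceTime n) (ρ : ℝ),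
    0 < ρ → p₀ ∈ D → cylE p₀.1 p₀.2 ρ ⊆ D →
    ParabolicTest φ (cylE p₀.1 p₀.2 ρ) φt gφ Hφ →
    TouchesBelow φ u (cylE p₀.1 p₀.2 ρ) p₀ →
    F (Hφ p₀) ≤ φt p₀

end

/-- The last ("vertical") coordinate `xₙ` of a point in `ℝⁿ = ℝ^{d+1}`. -/
def lastC {d : ℕ} (x : Eucl (d + 1)) : ℝ := x (Fin.last d)

/-- `K_r = (B_r ∩ {xₙ > 0}) × (−r, 0]`. -/
def Kc (d : ℕ) (r : ℝ) : Set (SpaceTime (d + 1)) :=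
  {p | p.1 ∈ ball 0 r ∧ 0 < lastC p.1 ∧ p.2 ∈ Ioc (-r) 0}

/-- `F_r = (B_r ∩ {xₙ = 0}) × (−r, 0]`. -/
def Fc (d : ℕ) (r : ℝ) : Set (SpaceTime (d + 1)) :=
  {p | p.1 ∈ ball 0 r ∧ lastC p.1 = 0 ∧ p.2 ∈ Ioc (-r) 0}

/-- `K_r⁺ = K_r ∪ F_r`. -/
def KcP (d : ℕ) (r : ℝ) : Set (SpaceTime (d + 1)) := Kc d r ∪ Fc d r

/-- The Dirichlet part `∂_b K₁` of the boundary of `K₁`: the part of the topological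
boundary not contained in `F₁ ∪ ((B₁ ∩ {xₙ>0}) × {0})`. -/
def bdryK (d : ℕ) : Set (SpaceTime (d + 1)) :=
  frontier (Kc d 1) \
    (Fc d 1 ∪ {p | p.1 ∈ ball 0 1 ∧ 0 < lastC p.1 ∧ p.2 = 0})

/-- Coefficient data for the linearized oblique problem: `Q` is symmetric, uniformly
elliptic, differentiable (entrywise, with derivative `Q'`) with `‖Q'‖ ≤ C₀/λ`, and the
oblique vector `v` is differentiable with `vₙ ≥ M⁻¹`, `|v| ≤ M`, `|v'| ≤ λ⁻¹`. -/
structure ObliqueData (d : ℕ) (lam Λ M C₀ : ℝ)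
    (Q Q' : ℝ → Matrix (Fin (d + 1)) (Fin (d + 1)) ℝ)
    (v v' : ℝ → Eucl (d + 1)) : Prop where
  lam_pos : 0 < lam
  lam_le_one : lam ≤ 1
  Lam_ge_one : 1 ≤ Λ
  M_ge_one : 1 ≤ M
  C0_pos : 0 < C₀
  Qsymm : ∀ t ∈ Icc (-1 : ℝ) 0, (Q t).IsSymm
  Qlower : ∀ t ∈ Icc (-1 : ℝ) 0,
    (Q t - (Λ * M ^ 2)⁻¹ • (1 : Matrix (Fin (d + 1)) (Fin (d + 1)) ℝ)).PosSemidef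
  Qupper : ∀ t ∈ Icc (-1 : ℝ) 0,
    ((Λ * M ^ 2) • (1 : Matrix (Fin (d + 1)) (Fin (d + 1)) ℝ) - Q t).PosSemidef
  Qderiv : ∀ t ∈ Icc (-1 : ℝ) 0, ∀ i j,
    HasDerivWithinAt (fun s => Q s i j) (Q' t i j) (Icc (-1 : ℝ) 0) t
  Qderiv_bound : ∀ t ∈ Icc (-1 : ℝ) 0, matOpNorm (Q' t) ≤ C₀ / lam
  vderiv : ∀ t ∈ Icc (-1 : ℝ) 0, HasDerivWithinAt v (v' t) (Icc (-1 : ℝ) 0) t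
  vlast : ∀ t ∈ Icc (-1 : ℝ) 0, M⁻¹ ≤ lastC (v t)
  vbound : ∀ t ∈ Icc (-1 : ℝ) 0, ‖v t‖ ≤ M
  vderiv_bound : ∀ t ∈ Icc (-1 : ℝ) 0, ‖v' t‖ ≤ lam⁻¹

/-- `η` is a viscosity subsolution of the linearized oblique problem
`λ η_t = tr(Q(t) D²η)` in `K₁`, `η_t = v(t)·∇η` on `F₁`. -/
def ObliqueSub (d : ℕ) (lam : ℝ) (Q : ℝ → Matrix (Fin (d + 1)) (Fin (d + 1)) ℝ)
    (v : ℝ → Eucl (d + 1)) (η : SpaceTime (d + 1) → ℝ) : Prop :=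
  ContinuousOn η (KcP d 1) ∧
  ∀ (φ φt : SpaceTime (d + 1) → ℝ) (gφ : SpaceTime (d + 1) → Eucl (d + 1))
    (Hφ : SpaceTime (d + 1) → Matrix (Fin (d + 1)) (Fin (d + 1)) ℝ)
    (p₀ : SpaceTime (d + 1)) (ρ : ℝ),
    0 < ρ →
    ParabolicTest φ (cylE p₀.1 p₀.2 ρ ∩ closure (Kc d 1)) φt gφ Hφ →
    TouchesAbove φ η (cylE p₀.1 p₀.2 ρ ∩ closure (Kc d 1)) p₀ →
    (p₀ ∈ Kc d 1 → lam * φt p₀ ≤ (Q p₀.2 * Hφ p₀).trace) ∧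
    (p₀ ∈ Fc d 1 → φt p₀ ≤ ⟪v p₀.2, gφ p₀⟫)

/-- `η` is a viscosity supersolution of the linearized oblique problem. -/
def ObliqueSup (d : ℕ) (lam : ℝ) (Q : ℝ → Matrix (Fin (d + 1)) (Fin (d + 1)) ℝ)
    (v : ℝ → Eucl (d + 1)) (η : SpaceTime (d + 1) → ℝ) : Prop :=
  ContinuousOn η (KcP d 1) ∧
  ∀ (φ φt : SpaceTime (d + 1) → ℝ) (gφ : SpaceTime (d + 1) → Eucl (d + 1))
    (Hφ : SpaceTime (d + 1) → Matrix (Fin (d + 1)) (Fin (d + 1)) ℝ)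
    (p₀ : SpaceTime (d + 1)) (ρ : ℝ),
    0 < ρ →
    ParabolicTest φ (cylE p₀.1 p₀.2 ρ ∩ closure (Kc d 1)) φt gφ Hφ →
    TouchesBelow φ η (cylE p₀.1 p₀.2 ρ ∩ closure (Kc d 1)) p₀ →
    (p₀ ∈ Kc d 1 → (Q p₀.2 * Hφ p₀).trace ≤ lam * φt p₀) ∧
    (p₀ ∈ Fc d 1 → ⟪v p₀.2, gφ p₀⟫ ≤ φt p₀)

/-- `η` is a viscosity solution of the linearized oblique problem on `K₁⁺`. -/
def ObliqueSolution (d : ℕ) (lam : ℝ) (Q : ℝ → Matrix (Fin (d + 1)) (Fin (d + 1)) ℝ)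
    (v : ℝ → Eucl (d + 1)) (η : SpaceTime (d + 1) → ℝ) : Prop :=
  ObliqueSub d lam Q v η ∧ ObliqueSup d lam Q v η

/-- The distance `|x' − y'|` between the horizontal projections. -/
noncomputable def primeDist {d : ℕ} (x y : Eucl (d + 1)) : ℝ :=
  Real.sqrt (∑ i : Fin d, (x i.castSucc - y i.castSucc) ^ 2)

/-- The boundary-adapted parabolic distance `d(·,·)`. -/
noncomputable def pdist {d : ℕ} (P₁ P₂ : SpaceTime (d + 1)) : ℝ :=
  primeDist P₁.1 P₂.1 +
    min (|lastC P₁.1| + |lastC P₂.1| + |P₁.2 - P₂.2|)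
      (|lastC P₁.1 - lastC P₂.1| + Real.sqrt |P₁.2 - P₂.2|)

/-- The rescaled distance `d_λ(P₁,P₂) = λ⁻¹ d(λP₁, λP₂)`. -/
noncomputable def pdistL {d : ℕ} (lam : ℝ) (P₁ P₂ : SpaceTime (d + 1)) : ℝ :=
  lam⁻¹ * pdist (lam • P₁.1, lam * P₁.2) (lam • P₂.1, lam * P₂.2)



/-- matrix as continuous linear map -/
noncomputable abbrev mclm {n : ℕ} (A : Matrix (Fin n) (Fin n) ℝ) : Eucl n →L[ℝ] Eucl n :=
  LinearMap.toContinuousLinearMap (Matrix.toEuclideanLin A)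

/-- tensor product of vectors -/
def tens {n : ℕ} (a b : Eucl n) : Matrix (Fin n) (Fin n) ℝ := fun i j => a i * b j

lemma mclm_apply {n : ℕ} (A : Matrix (Fin n) (Fin n) ℝ) (w : Eucl n) (i : Fin n) :
    mclm A w i = ∑ j, A i j * w j := by
  simp [mclm, Matrix.toEuclideanLin, Matrix.mulVec, dotProduct]

lemma inner_sum' {n : ℕ} (a b : Eucl n) : ⟪a, b⟫ = ∑ i, a i * b i := by
  simp [PiLp.inner_apply, mul_comm]

lemma mclm_tens {n : ℕ} (a b w : Eucl n) : mclm (tens a b) w = ⟪b, w⟫ • a := by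
  ext i
  rw [mclm_apply, PiLp.smul_apply, inner_sum', smul_eq_mul, Finset.sum_mul]
  refine Finset.sum_congr rfl fun j _ => ?_
  simp only [tens]; ring

lemma mclm_add {n : ℕ} (A B : Matrix (Fin n) (Fin n) ℝ) : mclm (A + B) = mclm A + mclm B := by
  simp [mclm]

lemma mclm_smul {n : ℕ} (c : ℝ) (A : Matrix (Fin n) (Fin n) ℝ) : mclm (c • A) = c • mclm A := by
  simp [mclm]

lemma continuousOn_tens {n : ℕ} {X : Type*} [TopologicalSpace X] {D : Set X} {a b : X → Eucl n}
    (ha : ContinuousOn a D) (hb : ContinuousOn b D) :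
    ContinuousOn (fun p => tens (a p) (b p)) D := by
  refine continuousOn_pi.2 fun i => continuousOn_pi.2 fun j => ?_
  have h1 : Continuous (fun x : Eucl n => x i) := by fun_prop
  have h2 : Continuous (fun x : Eucl n => x j) := by fun_prop
  exact (h1.comp_continuousOn ha).mul (h2.comp_continuousOn hb)

namespace ParabolicTest
variable {n : ℕ} {D : Set (SpaceTime n)}
variable {φ φt ψ ψt : SpaceTime n → ℝ} {gφ gψ : SpaceTime n → Eucl n}
    {Hφ Hψ : SpaceTime n → Matrix (Fin n) (Fin n) ℝ}

lemma mono {D' : Set (SpaceTime n)} (h : ParabolicTest φ D φt gφ Hφ) (hs : D' ⊆ D) :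
    ParabolicTest φ D' φt gφ Hφ where
  contPhi := h.contPhi.mono hs
  contPhit := h.contPhit.mono hs
  contGrad := h.contGrad.mono hs
  contHess := h.contHess.mono hs
  symmHess p hp := h.symmHess p (hs hp)
  timeDeriv p hp := (h.timeDeriv p (hs hp)).mono fun _ hq => hs hq
  spaceGrad p hp := HasFDerivWithinAt.mono (h.spaceGrad p (hs hp)) fun _ hq => hs hq
  spaceHess p hp := (h.spaceHess p (hs hp)).mono fun _ hq => hs hq

lemma time {a a' : ℝ → ℝ} (ha : ∀ p ∈ D, HasDerivAt a (a' p.2) p.2)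
    (ha' : ∀ p ∈ D, ContinuousAt a' p.2) :
    ParabolicTest (fun p => a p.2) D (fun p => a' p.2) (fun _ => 0) (fun _ => 0) where
  contPhi p hp := ((ha p hp).continuousAt.comp (continuous_snd.continuousAt)).continuousWithinAt
  contPhit p hp := (ContinuousAt.comp (f := Prod.snd) (ha' p hp)
    (continuous_snd.continuousAt)).continuousWithinAt
  contGrad := continuousOn_const
  contHess := continuousOn_const
  symmHess p hp := by simp [Matrix.IsSymm]
  timeDeriv p hp := (ha p hp).hasDerivWithinAt
  spaceGrad p hp := by
    rw [hasGradientWithinAt_iff_hasFDerivWithinAt, map_zero]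
    exact hasFDerivWithinAt_const (a p.2) p.1 _
  spaceHess p hp := by
    simp only [map_zero]
    exact hasFDerivWithinAt_const (0 : Eucl n) p.1 _

lemma const (c : ℝ) : ParabolicTest (fun _ => c) D (fun _ => 0) (fun _ => 0) (fun _ => 0) :=
  time (a := fun _ => c) (a' := fun _ => 0) (fun _ _ => hasDerivAt_const _ _)
    (fun _ _ => continuousAt_const)

lemma space {f : Eucl n → ℝ} {g : Eucl n → Eucl n} {H : Eucl n → Matrix (Fin n) (Fin n) ℝ}
    (hf : ∀ x, HasGradientAt f (g x) x) (hg : ∀ x, HasFDerivAt g (mclm (H x)) x)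
    (hH : Continuous H) (hs : ∀ x, (H x).IsSymm) :
    ParabolicTest (fun p => f p.1) D (fun _ => 0) (fun p => g p.1) (fun p => H p.1) where
  contPhi := by
    have : Continuous f := continuous_iff_continuousAt.2 fun x => (hf x).hasFDerivAt.continuousAt
    exact (this.comp continuous_fst).continuousOn
  contPhit := continuousOn_const
  contGrad := by
    have : Continuous g := continuous_iff_continuousAt.2 fun x => (hg x).continuousAt
    exact (this.comp continuous_fst).continuousOn
  contHess := (hH.comp continuous_fst).continuousOn
  symmHess p hp := hs _
  timeDeriv p hp := hasDerivWithinAt_const p.2 _ (f p.1)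
  spaceGrad p hp := by
    rw [hasGradientWithinAt_iff_hasFDerivWithinAt]
    exact (hf p.1).hasFDerivAt.hasFDerivWithinAt
  spaceHess p hp := (hg p.1).hasFDerivWithinAt

lemma linear (w : Eucl n) :
    ParabolicTest (fun p => ⟪w, p.1⟫) D (fun _ => 0) (fun _ => w) (fun _ => 0) := by
  refine space (f := fun x => ⟪w, x⟫) (g := fun _ => w) (H := fun _ => 0) ?_ ?_ continuous_const
    (fun _ => by simp [Matrix.IsSymm])
  · intro x
    rw [hasGradientAt_iff_hasFDerivAt]
    exact (InnerProductSpace.toDual ℝ (Eucl n) w).hasFDerivAt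
  · intro x
    simp only [mclm, map_zero]
    exact hasFDerivAt_const _ _

lemma add (h1 : ParabolicTest φ D φt gφ Hφ) (h2 : ParabolicTest ψ D ψt gψ Hψ) :
    ParabolicTest (fun p => φ p + ψ p) D (fun p => φt p + ψt p) (fun p => gφ p + gψ p)
      (fun p => Hφ p + Hψ p) where
  contPhi := h1.contPhi.add h2.contPhi
  contPhit := h1.contPhit.add h2.contPhit
  contGrad := h1.contGrad.add h2.contGrad
  contHess := h1.contHess.add h2.contHess
  symmHess p hp := (h1.symmHess p hp).add (h2.symmHess p hp)
  timeDeriv p hp := (h1.timeDeriv p hp).add (h2.timeDeriv p hp)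
  spaceGrad p hp := by
    rw [hasGradientWithinAt_iff_hasFDerivWithinAt, map_add]
    exact (h1.spaceGrad p hp).hasFDerivWithinAt.add (h2.spaceGrad p hp).hasFDerivWithinAt
  spaceHess p hp := by
    have := (h1.spaceHess p hp).add (h2.spaceHess p hp)
    simpa only [map_add] using! this

lemma mul (h1 : ParabolicTest φ D φt gφ Hφ) (h2 : ParabolicTest ψ D ψt gψ Hψ) :
    ParabolicTest (fun p => φ p * ψ p) D (fun p => φt p * ψ p + φ p * ψt p)
      (fun p => φ p • gψ p + ψ p • gφ p)
      (fun p => (φ p • Hψ p + tens (gψ p) (gφ p)) + (ψ p • Hφ p + tens (gφ p) (gψ p))) where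
  contPhi := h1.contPhi.mul h2.contPhi
  contPhit := (h1.contPhit.mul h2.contPhi).add (h1.contPhi.mul h2.contPhit)
  contGrad := (h1.contPhi.smul h2.contGrad).add (h2.contPhi.smul h1.contGrad)
  contHess := ((h1.contPhi.smul h2.contHess).add (continuousOn_tens h2.contGrad h1.contGrad)).add
    ((h2.contPhi.smul h1.contHess).add (continuousOn_tens h1.contGrad h2.contGrad))
  symmHess p hp := by
    have e1 := h1.symmHess p hp
    have e2 := h2.symmHess p hp
    ext i j
    have a1 := e1.apply i j
    have a2 := e2.apply i j
    simp only [Matrix.transpose_apply, Matrix.add_apply, Matrix.smul_apply, tens, smul_eq_mul,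
      a1, a2]
    ring
  timeDeriv p hp := (h1.timeDeriv p hp).mul (h2.timeDeriv p hp)
  spaceGrad p hp := by
    rw [hasGradientWithinAt_iff_hasFDerivWithinAt]
    have := (h1.spaceGrad p hp).hasFDerivWithinAt.mul (h2.spaceGrad p hp).hasFDerivWithinAt
    simpa only [map_add, map_smul, LinearIsometryEquiv.map_smulₛₗ, RingHom.id_apply,
      conj_trivial] using! this
  spaceHess p hp := by
    have k1 := (h1.spaceGrad p hp).hasFDerivWithinAt.smul (h2.spaceHess p hp)
    have k2 := (h2.spaceGrad p hp).hasFDerivWithinAt.smul (h1.spaceHess p hp)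
    refine (k1.add k2).congr_fderiv ?_
    change _ = mclm _
    rw [mclm_add, mclm_add, mclm_add, mclm_smul, mclm_smul]
    ext1 w
    simp only [_root_.add_apply, mclm_tens]
    simp [InnerProductSpace.toDual_apply_apply]

lemma comp {G G' G'' : ℝ → ℝ} (h1 : ParabolicTest φ D φt gφ Hφ)
    (hG : ∀ z, HasDerivAt G (G' z) z) (hG' : ∀ z, HasDerivAt G' (G'' z) z) (hc : Continuous G'') :
    ParabolicTest (fun p => G (φ p)) D (fun p => G' (φ p) * φt p)
      (fun p => G' (φ p) • gφ p)
      (fun p => G' (φ p) • Hφ p + G'' (φ p) • tens (gφ p) (gφ p)) := by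
  have c0 : Continuous G := continuous_iff_continuousAt.2 fun z => (hG z).continuousAt
  have c1 : Continuous G' := continuous_iff_continuousAt.2 fun z => (hG' z).continuousAt
  exact {
  contPhi := c0.comp_continuousOn h1.contPhi
  contPhit := (c1.comp_continuousOn h1.contPhi).mul h1.contPhit
  contGrad := (c1.comp_continuousOn h1.contPhi).smul h1.contGrad
  contHess := ((c1.comp_continuousOn h1.contPhi).smul h1.contHess).add
    ((hc.comp_continuousOn h1.contPhi).smul (continuousOn_tens h1.contGrad h1.contGrad))
  symmHess := fun p hp => by
    have e1 := h1.symmHess p hp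
    ext i j
    have a1 := e1.apply i j
    simp only [Matrix.transpose_apply, Matrix.add_apply, Matrix.smul_apply, tens, smul_eq_mul, a1]
    ring
  timeDeriv := fun p hp => (hG (φ p)).comp_hasDerivWithinAt (h₂ := G) p.2 (h1.timeDeriv p hp)
  spaceGrad := fun p hp => by
    rw [hasGradientWithinAt_iff_hasFDerivWithinAt]
    have := (hG (φ p)).comp_hasFDerivWithinAt p.1 (h1.spaceGrad p hp).hasFDerivWithinAt
    simpa only [map_smul, LinearIsometryEquiv.map_smulₛₗ, RingHom.id_apply,
      conj_trivial] using! this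
  spaceHess := fun p hp => by
    have k := (hG' (φ p)).comp_hasFDerivWithinAt p.1 (h1.spaceGrad p hp).hasFDerivWithinAt
    have k1 := k.smul (h1.spaceHess p hp)
    refine k1.congr_fderiv ?_
    change _ = mclm _
    rw [mclm_add, mclm_smul, mclm_smul]
    ext1 w
    simp only [_root_.add_apply, _root_.smul_apply, mclm_tens]
    simp [InnerProductSpace.toDual_apply_apply, smul_smul] }

lemma cmul (c : ℝ) (h1 : ParabolicTest φ D φt gφ Hφ) :
    ParabolicTest (fun p => c * φ p) D (fun p => c * φt p) (fun p => c • gφ p)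
      (fun p => c • Hφ p) := by
  have := h1.comp (G := fun z => c * z) (G' := fun _ => c) (G'' := fun _ => 0)
    (fun z => by simpa using (hasDerivAt_id z).const_mul c) (fun z => hasDerivAt_const _ _)
    continuous_const
  simpa using this

lemma addc (c : ℝ) (h1 : ParabolicTest φ D φt gφ Hφ) :
    ParabolicTest (fun p => φ p + c) D φt gφ Hφ := by
  have := h1.add (const (D := D) c)
  simpa using this

lemma sum {ι : Type*} (S : Finset ι) {φ φt : ι → SpaceTime n → ℝ} {gφ : ι → SpaceTime n → Eucl n}
    {Hφ : ι → SpaceTime n → Matrix (Fin n) (Fin n) ℝ}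
    (h : ∀ k ∈ S, ParabolicTest (φ k) D (φt k) (gφ k) (Hφ k)) :
    ParabolicTest (fun p => ∑ k ∈ S, φ k p) D (fun p => ∑ k ∈ S, φt k p)
      (fun p => ∑ k ∈ S, gφ k p) (fun p => ∑ k ∈ S, Hφ k p) := by
  classical
  induction S using Finset.induction_on with
  | empty => simpa using const (D := D) 0
  | insert a S ha ih =>
    simp only [Finset.sum_insert ha]
    exact (h a (by simp)).add (ih fun k hk => h k (by simp [hk]))

end ParabolicTest


lemma supA {d : ℕ} {lam : ℝ} {Q : ℝ → Matrix (Fin (d + 1)) (Fin (d + 1)) ℝ}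
    {v : ℝ → Eucl (d + 1)} {η : SpaceTime (d + 1) → ℝ} (h : ObliqueSup d lam Q v η)
    {a : ℝ} (ha : 0 < a) (b : ℝ) : ObliqueSup d lam Q v (fun p => a * η p + b) := by
  refine ⟨(h.1.const_smul a).add continuousOn_const, ?_⟩
  intro φ φt g H p₀ ρ hρ hT hB
  have hT' := ((hT.addc (-b)).cmul a⁻¹)
  have := h.2 _ _ _ _ p₀ ρ hρ hT' ⟨hB.1, ?_, ?_⟩
  · refine ⟨fun hp => ?_, fun hp => ?_⟩
    · have := this.1 hp
      rw [Matrix.mul_smul, Matrix.trace_smul, smul_eq_mul] at this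
      have := mul_le_mul_of_nonneg_left this ha.le
      field_simp at this
      linarith
    · have := this.2 hp
      rw [inner_smul_right] at this
      have := mul_le_mul_of_nonneg_left this ha.le
      field_simp at this
      linarith
  · have := hB.2.1
    simp only [this]; field_simp; ring
  · intro p hp
    have := hB.2.2 p hp
    rw [inv_mul_le_iff₀ ha]; linarith

lemma subA {d : ℕ} {lam : ℝ} {Q : ℝ → Matrix (Fin (d + 1)) (Fin (d + 1)) ℝ}
    {v : ℝ → Eucl (d + 1)} {η : SpaceTime (d + 1) → ℝ} (h : ObliqueSub d lam Q v η)
    {a : ℝ} (ha : 0 < a) (b : ℝ) : ObliqueSup d lam Q v (fun p => b - a * η p) := by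
  refine ⟨continuousOn_const.sub (h.1.const_smul a), ?_⟩
  intro φ φt g H p₀ ρ hρ hT hB
  have hT' := ((hT.addc (-b)).cmul (-a⁻¹))
  have := h.2 _ _ _ _ p₀ ρ hρ hT' ⟨hB.1, ?_, ?_⟩
  · refine ⟨fun hp => ?_, fun hp => ?_⟩
    · have := this.1 hp
      rw [Matrix.mul_smul, Matrix.trace_smul, smul_eq_mul] at this
      have := mul_le_mul_of_nonneg_left this ha.le
      field_simp at this
      linarith
    · have := this.2 hp
      rw [inner_smul_right] at this
      have := mul_le_mul_of_nonneg_left this ha.le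
      field_simp at this
      linarith
  · have := hB.2.1
    simp only [this]; field_simp; ring
  · intro p hp
    have := hB.2.2 p hp
    have h2 : η p * a ≤ b - φ p := by linarith
    have := (le_div_iff₀ ha).2 h2
    calc η p ≤ _ := this
      _ = _ := by field_simp; ring

lemma continuous_lastC {d : ℕ} : Continuous (lastC : Eucl (d + 1) → ℝ) := by
  unfold lastC; fun_prop

/-- comparison region -/
def Om (d : ℕ) (c : Eucl (d + 1)) (r ta tb : ℝ) : Set (SpaceTime (d + 1)) :=
  {p | ‖p.1 - c‖ ≤ r ∧ 0 ≤ lastC p.1 ∧ p.2 ∈ Icc ta tb}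

lemma isCompact_Om (d : ℕ) (c : Eucl (d + 1)) (r ta tb : ℝ) : IsCompact (Om d c r ta tb) := by
  have h1 : IsCompact ((closedBall c r) ×ˢ (Icc ta tb)) :=
    (isCompact_closedBall c r).prod isCompact_Icc
  refine h1.of_isClosed_subset ?_ ?_
  · have a1 : IsClosed {p : SpaceTime (d + 1) | ‖p.1 - c‖ ≤ r} :=
      isClosed_le (by fun_prop) continuous_const
    have a2 : IsClosed {p : SpaceTime (d + 1) | 0 ≤ lastC p.1} :=
      isClosed_le continuous_const (continuous_lastC.comp continuous_fst)
    have a3 : IsClosed {p : SpaceTime (d + 1) | p.2 ∈ Icc ta tb} :=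
      isClosed_Icc.preimage continuous_snd
    exact a1.inter (a2.inter a3)
  · rintro p ⟨h1, h2, h3⟩
    exact ⟨by simpa [mem_closedBall, dist_eq_norm] using h1, h3⟩

lemma Om_sub {d : ℕ} {c : Eucl (d + 1)} {r ta tb : ℝ} (hc : ‖c‖ + r < 1) (hta : -1 < ta)
    (htb : tb ≤ 0) : Om d c r ta tb ⊆ KcP d 1 := by
  rintro p ⟨h1, h2, h3, h4⟩
  have hb : p.1 ∈ ball (0 : Eucl (d + 1)) 1 := by
    rw [mem_ball_zero_iff]
    have : ‖p.1‖ ≤ ‖p.1 - c‖ + ‖c‖ := by simpa using norm_add_le (p.1 - c) c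
    linarith
  have ht : p.2 ∈ Ioc (-1 : ℝ) 0 := ⟨by linarith, by linarith⟩
  rcases h2.lt_or_eq with h | h
  · exact Or.inl ⟨hb, h, ht⟩
  · exact Or.inr ⟨hb, h.symm, ht⟩

lemma closure_Kc_sub {d : ℕ} : closure (Kc d 1) ⊆ {p | 0 ≤ lastC p.1} := by
  refine closure_minimal ?_ (isClosed_le continuous_const (continuous_lastC.comp continuous_fst))
  rintro p ⟨_, h, _⟩
  exact h.le

lemma KcP_sub_closure {d : ℕ} : KcP d 1 ⊆ closure (Kc d 1) := by
  rintro p (h | h)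
  · exact subset_closure h
  · obtain ⟨h1, h2, h3⟩ := h
    have hc : Continuous (fun s : ℝ => ((p.1 + s • EuclideanSpace.single (Fin.last d) (1 : ℝ), p.2)
        : SpaceTime (d + 1))) := by fun_prop
    have ht : Filter.Tendsto (fun s : ℝ => ((p.1 + s • EuclideanSpace.single (Fin.last d) (1 : ℝ),
        p.2) : SpaceTime (d + 1))) (nhdsWithin 0 (Ioi 0)) (nhds p) := by
      have := (hc.tendsto 0).mono_left (nhdsWithin_le_nhds (s := Ioi 0))
      simpa using this
    refine mem_closure_of_tendsto ht ?_
    have e1 : ∀ᶠ s : ℝ in nhdsWithin 0 (Ioi 0),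
        p.1 + s • EuclideanSpace.single (Fin.last d) (1 : ℝ) ∈ ball (0 : Eucl (d + 1)) 1 := by
      have hc' : Continuous (fun s : ℝ => p.1 + s • EuclideanSpace.single (Fin.last d) (1 : ℝ)) := by
        fun_prop
      exact ((hc'.tendsto 0).mono_left (nhdsWithin_le_nhds (s := Ioi 0))).eventually
        (isOpen_ball.mem_nhds (by simpa using h1))
    filter_upwards [e1, self_mem_nhdsWithin] with s hs1 hs2
    refine ⟨hs1, ?_, h3⟩
    have : (0 : ℝ) < s := hs2
    simp only [lastC] at h2 ⊢
    simpa [h2] using this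

lemma compare {d : ℕ} {lam : ℝ} {Q : ℝ → Matrix (Fin (d + 1)) (Fin (d + 1)) ℝ}
    {v : ℝ → Eucl (d + 1)} {η : SpaceTime (d + 1) → ℝ} (hη : ObliqueSup d lam Q v η)
    {c : Eucl (d + 1)} {r ta tb : ℝ} (hc : ‖c‖ + r < 1) (hta : -1 < ta) (htb : tb ≤ 0)
    {φ : SpaceTime (d + 1) → ℝ} (hφ : ContinuousOn φ (Om d c r ta tb))
    (hinit : ∀ p ∈ Om d c r ta tb, p.2 = ta → φ p ≤ η p)
    (hlat : ∀ p ∈ Om d c r ta tb, ‖p.1 - c‖ = r → φ p ≤ η p)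
    (htest : ∀ p ∈ Om d c r ta tb, ta < p.2 → ‖p.1 - c‖ < r → η p < φ p →
      ∃ (φ1 φt : SpaceTime (d + 1) → ℝ) (g : SpaceTime (d + 1) → Eucl (d + 1))
        (H : SpaceTime (d + 1) → Matrix (Fin (d + 1)) (Fin (d + 1)) ℝ),
        ParabolicTest φ1 {q | ta < q.2} φt g H ∧
        (∀ q ∈ Om d c r ta tb, ta < q.2 → φ1 q ≤ φ q) ∧ φ1 p = φ p ∧
        (0 < lastC p.1 → lam * φt p < (Q p.2 * H p).trace) ∧
        (lastC p.1 = 0 → φt p < ⟪v p.2, g p⟫)) :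
    ∀ p ∈ Om d c r ta tb, φ p ≤ η p := by
  by_contra! hcon
  obtain ⟨q0, hq0, hq0'⟩ := hcon
  have hcont : ContinuousOn (fun p => φ p - η p) (Om d c r ta tb) :=
    hφ.sub (hη.1.mono (Om_sub hc hta htb))
  obtain ⟨p, hp, hmax⟩ := (isCompact_Om d c r ta tb).exists_isMaxOn ⟨q0, hq0⟩ hcont
  have hpos : η p < φ p := by
    have := hmax hq0
    simp only [mem_setOf_eq] at this
    linarith
  have hp1 : ta < p.2 := by
    rcases hp.2.2.1.lt_or_eq with h | h
    · exact h
    · have := hinit p hp h.symm; linarith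
  have hp2 : ‖p.1 - c‖ < r := by
    rcases hp.1.lt_or_eq with h | h
    · exact h
    · have := hlat p hp h; linarith
  obtain ⟨φ1, φt, g, H, hT, hle, heq, hin, hbd⟩ := htest p hp hp1 hp2 hpos
  set ρ := min (r - ‖p.1 - c‖) (min (p.2 - ta) 1) with hρd
  have hρ : 0 < ρ := by
    rw [hρd]; refine lt_min (by linarith) (lt_min (by linarith) one_pos)
  have hρ1 : ρ ≤ r - ‖p.1 - c‖ := min_le_left _ _
  have hρ2 : ρ ≤ p.2 - ta := (min_le_right _ _).trans (min_le_left _ _)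
  have hρ3 : ρ ≤ 1 := (min_le_right _ _).trans (min_le_right _ _)
  have hsub : cylE p.1 p.2 ρ ∩ closure (Kc d 1) ⊆ Om d c r ta tb ∩ {q | ta < q.2} := by
    rintro q ⟨⟨h1, h2, h3⟩, h4⟩
    have hq2 : ta < q.2 := by nlinarith
    refine ⟨⟨?_, closure_Kc_sub h4, hq2.le, h3.trans hp.2.2.2⟩, hq2⟩
    have h5 : ‖q.1 - p.1‖ < ρ := by simpa [mem_ball, dist_eq_norm] using h1
    have : ‖q.1 - c‖ ≤ ‖q.1 - p.1‖ + ‖p.1 - c‖ := by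
      simpa using norm_add_le (q.1 - p.1) (p.1 - c)
    linarith
  have hT' := (hT.addc (-(φ p - η p))).mono (hsub.trans inter_subset_right)
  have key := hη.2 _ _ _ _ p ρ hρ hT' ⟨⟨⟨by simpa [mem_ball] using hρ, by nlinarith, le_rfl⟩,
    KcP_sub_closure (Om_sub hc hta htb hp)⟩, ?_, ?_⟩
  · have hpK := Om_sub hc hta htb hp
    rcases hpK with h | h
    · have := key.1 h; have := hin h.2.1; linarith
    · have := key.2 h; have := hbd h.2.1; linarith
  · show φ1 p + -(φ p - η p) = η p
    rw [heq]; ring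
  · intro q hq
    obtain ⟨hq1, hq2⟩ := hsub hq
    have := hle q hq1 hq2
    have := hmax hq1
    simp only [mem_setOf_eq] at this
    linarith

/-- Ellipticity in usable form. -/
structure Ell {n : ℕ} (θ Θ : ℝ) (A : Matrix (Fin n) (Fin n) ℝ) : Prop where
  psd : A.PosSemidef
  low : ∀ w : Eucl n, θ * ‖w‖ ^ 2 ≤ (A * tens w w).trace
  ent : ∀ i j, |A i j| ≤ Θ

lemma trace_tens {n : ℕ} (A : Matrix (Fin n) (Fin n) ℝ) (w : Eucl n) :
    (A * tens w w).trace = ∑ i, ∑ j, w i * A i j * w j := by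
  simp only [Matrix.trace, Matrix.diag, Matrix.mul_apply, tens]
  refine Finset.sum_congr rfl fun i _ => Finset.sum_congr rfl fun j _ => by ring

lemma psd_form {n : ℕ} {A : Matrix (Fin n) (Fin n) ℝ} (h : A.PosSemidef) (w : Eucl n) :
    0 ≤ ∑ i, ∑ j, w i * A i j * w j := by
  have := h.dotProduct_mulVec_nonneg (fun i => w i)
  simp only [dotProduct, Matrix.mulVec, star_trivial, Pi.star_apply] at this
  refine this.trans_eq ?_
  refine Finset.sum_congr rfl fun i _ => ?_
  rw [Finset.mul_sum]
  exact Finset.sum_congr rfl fun j _ => by ring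

lemma ell_of {n : ℕ} {θ Θ : ℝ} (hθ : 0 ≤ θ) {A : Matrix (Fin n) (Fin n) ℝ} (hs : A.IsSymm)
    (h1 : (A - θ • (1 : Matrix (Fin n) (Fin n) ℝ)).PosSemidef)
    (h2 : (Θ • (1 : Matrix (Fin n) (Fin n) ℝ) - A).PosSemidef) : Ell θ Θ A := by
  have hpsd : A.PosSemidef := by
    have : A = (A - θ • (1 : Matrix (Fin n) (Fin n) ℝ)) + θ • 1 := by simp
    rw [this]
    exact h1.add (Matrix.PosSemidef.one.smul hθ)
  have diag : ∀ i, A i i ≤ Θ := fun i => by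
    have := h2.diag_nonneg (i := i)
    simpa using this
  refine ⟨hpsd, fun w => ?_, fun i j => ?_⟩
  · rw [trace_tens]
    have := psd_form h1 w
    have e : ∑ i, ∑ j, w i * (A - θ • (1 : Matrix (Fin n) (Fin n) ℝ)) i j * w j
        = ∑ i, ∑ j, w i * A i j * w j - θ * ‖w‖ ^ 2 := by
      rw [EuclideanSpace.norm_sq_eq, Finset.mul_sum, ← Finset.sum_sub_distrib]
      refine Finset.sum_congr rfl fun i _ => ?_
      have : θ * ‖w i‖ ^ 2 = ∑ j, w i * (θ • (1 : Matrix (Fin n) (Fin n) ℝ)) i j * w j := by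
        rw [Finset.sum_eq_single i]
        · simp; ring
        · intro j _ hj; simp [Matrix.one_apply_ne hj.symm]
        · simp
      rw [this, ← Finset.sum_sub_distrib]
      refine Finset.sum_congr rfl fun j _ => ?_
      rw [Matrix.sub_apply]; ring
    linarith
  · by_cases hij : i = j
    · subst hij
      rw [abs_of_nonneg hpsd.diag_nonneg]; exact diag i
    · have key : ∀ s : ℝ, s * s = 1 → 0 ≤ A i i + A j j + 2 * s * A i j := by
        intro s hss
        have := hpsd.dotProduct_mulVec_nonneg (Pi.single i 1 + Pi.single j s)
        simp [Matrix.mulVec_add, Matrix.mulVec_single, dotProduct_add, add_dotProduct] at this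
        have e := hs.apply i j
        rw [e] at this
        have e2 : s * (s * A j j) = A j j := by rw [← mul_assoc, hss, one_mul]
        have e3 : s * (A i j + s * A j j) = s * A i j + A j j := by rw [mul_add, e2]
        linarith
      have k1 := key 1 (by norm_num)
      have k2 := key (-1) (by norm_num)
      have := diag i
      have := diag j
      rw [abs_le]; constructor <;> linarith

/-- sum of absolute values of entries -/
def sabs {n : ℕ} (H : Matrix (Fin n) (Fin n) ℝ) : ℝ := ∑ i, ∑ j, |H i j|

lemma continuous_sabs {n : ℕ} : Continuous (sabs : Matrix (Fin n) (Fin n) ℝ → ℝ) := by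
  unfold sabs; fun_prop

lemma Ell.trace_le {n : ℕ} {θ Θ : ℝ} {A : Matrix (Fin n) (Fin n) ℝ} (h : Ell θ Θ A)
    (H : Matrix (Fin n) (Fin n) ℝ) : |(A * H).trace| ≤ Θ * sabs H := by
  simp only [Matrix.trace, Matrix.diag, Matrix.mul_apply, sabs]
  rw [Finset.sum_comm (f := fun i j => |H i j|), Finset.mul_sum]
  refine (Finset.abs_sum_le_sum_abs _ _).trans (Finset.sum_le_sum fun i _ => ?_)
  rw [Finset.mul_sum]
  refine (Finset.abs_sum_le_sum_abs _ _).trans (Finset.sum_le_sum fun j _ => ?_)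
  rw [abs_mul]
  exact mul_le_mul_of_nonneg_right (h.ent i j) (abs_nonneg _)

lemma ObliqueData.ell {d : ℕ} {lam Λ M C₀ : ℝ}
    {Q Q' : ℝ → Matrix (Fin (d + 1)) (Fin (d + 1)) ℝ}
    {v v' : ℝ → Eucl (d + 1)} (h : ObliqueData d lam Λ M C₀ Q Q' v v') {t : ℝ}
    (ht : t ∈ Icc (-1 : ℝ) 0) : Ell (Λ * M ^ 2)⁻¹ (Λ * M ^ 2) (Q t) := by
  have := h.Lam_ge_one
  exact ell_of (by positivity) (h.Qsymm t ht) (h.Qlower t ht) (h.Qupper t ht)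

/-- If `A` is PSD and `H` is nonpositive as a form, the trace of the product is nonpositive. -/
lemma trace_nonpos_of {n : ℕ} {A : Matrix (Fin n) (Fin n) ℝ} (hA : A.PosSemidef)
    {H : Matrix (Fin n) (Fin n) ℝ} (hH : ∀ w : Eucl n, ⟪w, mclm H w⟫ ≤ 0) :
    (A * H).trace ≤ 0 := by
  obtain ⟨m, V, rfl⟩ := Matrix.posSemidef_iff_eq_sum_vecMulVec.mp hA
  rw [Finset.sum_mul, Matrix.trace_sum]
  refine Finset.sum_nonpos fun i _ => ?_
  have := hH (WithLp.toLp 2 (V i))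
  refine le_trans (le_of_eq ?_) this
  rw [inner_sum']
  simp only [Matrix.trace, Matrix.diag, Matrix.mul_apply, mclm_apply, Matrix.vecMulVec_apply,
    Pi.star_apply, star_trivial, Finset.mul_sum]
  rw [Finset.sum_comm]
  exact Finset.sum_congr rfl fun j _ => Finset.sum_congr rfl fun k _ => by ring


/-- global C2 data -/
structure IsC2 {n : ℕ} (f : Eucl n → ℝ) (g : Eucl n → Eucl n)
    (H : Eucl n → Matrix (Fin n) (Fin n) ℝ) : Prop where
  grad : ∀ x, HasGradientAt f (g x) x
  hess : ∀ x, HasFDerivAt g (mclm (H x)) x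
  contH : Continuous H
  symm : ∀ x, (H x).IsSymm

lemma IsC2.contG {n : ℕ} {f : Eucl n → ℝ} {g : Eucl n → Eucl n}
    {H : Eucl n → Matrix (Fin n) (Fin n) ℝ} (h : IsC2 f g H) : Continuous g :=
  continuous_iff_continuousAt.2 fun x => (h.hess x).continuousAt

lemma IsC2.contF {n : ℕ} {f : Eucl n → ℝ} {g : Eucl n → Eucl n}
    {H : Eucl n → Matrix (Fin n) (Fin n) ℝ} (h : IsC2 f g H) : Continuous f :=
  continuous_iff_continuousAt.2 fun x => (h.grad x).hasFDerivAt.continuousAt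

lemma IsC2.test {n : ℕ} {f : Eucl n → ℝ} {g : Eucl n → Eucl n}
    {H : Eucl n → Matrix (Fin n) (Fin n) ℝ} (h : IsC2 f g H) (D : Set (SpaceTime n)) :
    ParabolicTest (fun p => f p.1) D (fun _ => 0) (fun p => g p.1) (fun p => H p.1) :=
  ParabolicTest.space h.grad h.hess h.contH h.symm

lemma IsC2.inner_eq {n : ℕ} {f : Eucl n → ℝ} {g : Eucl n → Eucl n}
    {H : Eucl n → Matrix (Fin n) (Fin n) ℝ} (h : IsC2 f g H) {x : Eucl n} {L : Eucl n →L[ℝ] ℝ}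
    (hL : HasFDerivAt f L x) (w : Eucl n) : ⟪w, g x⟫ = L w := by
  have := (h.grad x).hasFDerivAt.unique hL
  rw [← this, real_inner_comm]; rfl

lemma exists_isC2 {n : ℕ} {f : Eucl n → ℝ} (hf : ContDiff ℝ 2 f) : ∃ g H, IsC2 f g H := by
  set L := (InnerProductSpace.toDual ℝ (Eucl n)).symm with hL
  let Lc : (Eucl n →L[ℝ] ℝ) →L[ℝ] Eucl n := 
    { toFun := fun l => L l
      map_add' := fun a b => map_add L a b
      map_smul' := fun c a => by simp
      cont := L.continuous }
  have h1 : ContDiff ℝ 1 (fderiv ℝ f) := hf.fderiv_right (by norm_num)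
  have h1d : Differentiable ℝ (fderiv ℝ f) := h1.differentiable (by norm_num)
  have h2 : Continuous (fderiv ℝ (fderiv ℝ f)) := h1.continuous_fderiv (by norm_num)
  have hLi : ∀ (l : Eucl n →L[ℝ] ℝ) (i : Fin n), L l i = l (EuclideanSpace.single i 1) := by
    intro l i
    have : ⟪L l, EuclideanSpace.single i (1 : ℝ)⟫ = l (EuclideanSpace.single i 1) := by
      rw [hL, InnerProductSpace.toDual_symm_apply]
    rw [← this, EuclideanSpace.inner_single_right]; simp
  refine ⟨fun x => L (fderiv ℝ f x), fun x => Matrix.of fun i j =>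
    fderiv ℝ (fderiv ℝ f) x (EuclideanSpace.single j 1) (EuclideanSpace.single i 1), ?_, ?_, ?_, ?_⟩
  · intro x
    rw [hasGradientAt_iff_hasFDerivAt]
    simp only [hL, LinearIsometryEquiv.apply_symm_apply]
    exact (hf.differentiable (by norm_num) x).hasFDerivAt
  · intro x
    have := Lc.hasFDerivAt.comp x (h1d x).hasFDerivAt
    refine this.congr_fderiv ?_
    ext w i
    rw [mclm_apply]
    show L (fderiv ℝ (fderiv ℝ f) x w) i = _
    rw [hLi]
    have hw : w = ∑ j, w j • EuclideanSpace.single j (1 : ℝ) := by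
      ext k; simp [Finset.sum_apply, Pi.single_apply]
    conv_lhs => rw [hw]
    rw [map_sum, _root_.sum_apply]
    refine Finset.sum_congr rfl fun j _ => ?_
    rw [map_smul, _root_.smul_apply, smul_eq_mul, mul_comm, Matrix.of_apply]
  · refine continuous_pi fun i => continuous_pi fun j => ?_
    exact (h2.clm_apply continuous_const).clm_apply continuous_const
  · intro x
    ext i j
    have : IsSymmSndFDerivAt ℝ f x := hf.contDiffAt.isSymmSndFDerivAt (by simp)
    exact this.eq _ _

lemma exists_pos_lower {X : Type*} [TopologicalSpace X] {K : Set X} (hK : IsCompact K)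
    {F : X → ℝ} (hF : ContinuousOn F K) (hpos : ∀ x ∈ K, 0 < F x) : ∃ c > 0, ∀ x ∈ K, c ≤ F x := by
  rcases K.eq_empty_or_nonempty with h | h
  · exact ⟨1, one_pos, by simp [h]⟩
  · obtain ⟨x, hx, hm⟩ := hK.exists_isMinOn h hF
    exact ⟨F x, hpos x hx, fun y hy => hm hy⟩

lemma exists_upper {X : Type*} [TopologicalSpace X] {K : Set X} (hK : IsCompact K)
    {F : X → ℝ} (hF : ContinuousOn F K) : ∃ c > 0, ∀ x ∈ K, F x ≤ c := by
  obtain ⟨c, hc⟩ := hK.bddAbove_image hF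
  exact ⟨max c 1, by positivity, fun x hx => (hc (mem_image_of_mem F hx)).trans (le_max_left _ _)⟩

/-- vertical unit vector -/
noncomputable def eV (d : ℕ) : Eucl (d + 1) := EuclideanSpace.single (Fin.last d) 1

lemma inner_eV {d : ℕ} (x : Eucl (d + 1)) : ⟪x, eV d⟫ = lastC x := by
  simp [eV, lastC, EuclideanSpace.inner_single_right]

lemma norm_eV {d : ℕ} : ‖eV d‖ = 1 := by simp [eV]
lemma lastC_eV {d : ℕ} : lastC (eV d) = 1 := by simp [eV, lastC]
lemma lastC_sub {d : ℕ} (x y : Eucl (d + 1)) : lastC (x - y) = lastC x - lastC y := rfl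
lemma lastC_smul {d : ℕ} (c : ℝ) (y : Eucl (d + 1)) : lastC (c • y) = c * lastC y := rfl

lemma abs_lastC_le {d : ℕ} (x : Eucl (d + 1)) : lastC x ^ 2 ≤ ‖x‖ ^ 2 := by
  have : |lastC x| ≤ ‖x‖ := by
    have := EuclideanSpace.norm_eq x
    rw [← inner_eV]
    simpa [norm_eV] using abs_real_inner_le_norm x (eV d)
  rw [← sq_abs]
  gcongr

/-- the last coordinate as CLM -/
noncomputable def lastL (d : ℕ) : Eucl (d + 1) →L[ℝ] ℝ := EuclideanSpace.proj (Fin.last d)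
lemma lastL_apply {d : ℕ} (x : Eucl (d + 1)) : lastL d x = lastC x := rfl

/-- half ball -/
def HB (d : ℕ) : Set (Eucl (d + 1)) := {x | 0 ≤ lastC x ∧ ‖x‖ ^ 2 ≤ 3 / 4}

lemma isCompact_HB (d : ℕ) : IsCompact (HB d) := by
  refine (isCompact_closedBall (0 : Eucl (d + 1)) 1).of_isClosed_subset ?_ ?_
  · exact (isClosed_le continuous_const continuous_lastC).inter
      (isClosed_le (f := fun x : Eucl (d + 1) => ‖x‖ ^ 2) (by fun_prop) continuous_const)
  · rintro x ⟨_, h⟩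
    rw [mem_closedBall_zero_iff]
    nlinarith [norm_nonneg x]

/-- horizontal square norm -/
noncomputable def rh {d : ℕ} (x : Eucl (d + 1)) : ℝ := ‖x‖ ^ 2 - lastC x ^ 2

lemma rh_nonneg {d : ℕ} (x : Eucl (d + 1)) : 0 ≤ rh x := by
  have := abs_lastC_le x; unfold rh; linarith

lemma hasFDerivAt_rh {d : ℕ} (x : Eucl (d + 1)) :
    HasFDerivAt rh (2 • innerSL ℝ x - (2 * lastC x) • lastL d) x := by
  have h1 : HasFDerivAt (fun x : Eucl (d + 1) => ‖x‖ ^ 2) (2 • innerSL ℝ x) x :=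
    (hasStrictFDerivAt_norm_sq x).hasFDerivAt
  have h2 : HasFDerivAt (fun x : Eucl (d + 1) => lastC x ^ 2) ((2 * lastC x) • lastL d) x := by
    have := ((lastL d).hasFDerivAt (x := x)).pow 2
    simpa [lastL_apply] using this
  exact h1.sub h2

lemma contDiff_lastC {d : ℕ} : ContDiff ℝ 2 (lastC : Eucl (d + 1) → ℝ) := (lastL d).contDiff
lemma contDiff_rh {d : ℕ} : ContDiff ℝ 2 (rh : Eucl (d + 1) → ℝ) :=
  (contDiff_norm_sq ℝ).sub (contDiff_lastC.pow 2)


lemma IsC2.of_test {n : ℕ} {f : Eucl n → ℝ} {g : Eucl n → Eucl n}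
    {H : Eucl n → Matrix (Fin n) (Fin n) ℝ} {φt : SpaceTime n → ℝ}
    (h : ParabolicTest (fun p => f p.1) univ φt (fun p => g p.1) (fun p => H p.1)) : IsC2 f g H where
  grad x := by
    have := h.spaceGrad (x, 0) trivial
    simpa using! this
  hess x := by
    have := h.spaceHess (x, 0) trivial
    simpa using! this
  contH := by
    have := h.contHess
    rw [continuousOn_univ] at this
    exact this.comp (f := fun x : Eucl n => ((x, 0) : SpaceTime n)) (by fun_prop)
  symm x := h.symmHess (x, 0) trivial

lemma IsC2.comp {n : ℕ} {f : Eucl n → ℝ} {g : Eucl n → Eucl n}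
    {H : Eucl n → Matrix (Fin n) (Fin n) ℝ} (h : IsC2 f g H) {G G' G'' : ℝ → ℝ}
    (hG : ∀ z, HasDerivAt G (G' z) z) (hG' : ∀ z, HasDerivAt G' (G'' z) z) (hc : Continuous G'') :
    IsC2 (fun x => G (f x)) (fun x => G' (f x) • g x)
      (fun x => G' (f x) • H x + G'' (f x) • tens (g x) (g x)) :=
  IsC2.of_test ((h.test univ).comp hG hG' hc)

lemma hasDerivAt_expmul (c : ℝ) (z : ℝ) :
    HasDerivAt (fun z => Real.exp (c * z)) (c * Real.exp (c * z)) z := by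
  have := ((hasDerivAt_id z).const_mul c).exp
  simpa [mul_comm] using this

/-- the profile for the barrier -/
noncomputable def hB (d : ℕ) (k : ℝ) (x : Eucl (d + 1)) : ℝ :=
  rh x * (3 / 4 + Real.exp (-k * lastC x) / 4) + lastC x ^ 2 + lastC x / 4

lemma contDiff_hB (d : ℕ) (k : ℝ) : ContDiff ℝ 2 (hB d k) := by
  unfold hB
  have h1 := contDiff_lastC (d := d)
  have h2 := contDiff_rh (d := d)
  have h3 : ContDiff ℝ 2 (fun x : Eucl (d + 1) => Real.exp (-k * lastC x)) :=
    (contDiff_const.mul h1).exp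
  exact ((h2.mul (contDiff_const.add (h3.div_const _))).add (h1.pow 2)).add (h1.div_const _)

lemma hasFDerivAt_hB (d : ℕ) (k : ℝ) (x : Eucl (d + 1)) : ∃ L : Eucl (d + 1) →L[ℝ] ℝ,
    HasFDerivAt (hB d k) L x ∧ ∀ w, L w =
      (3 / 4 + Real.exp (-k * lastC x) / 4) * (2 * ⟪x, w⟫ - 2 * lastC x * lastC w)
      + (rh x * (-k * Real.exp (-k * lastC x) / 4) + 2 * lastC x + 1 / 4) * lastC w := by
  have hl : HasFDerivAt (lastC : Eucl (d + 1) → ℝ) (lastL d) x := (lastL d).hasFDerivAt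
  have h1 := (hasDerivAt_expmul (-k) (lastC x)).comp_hasFDerivAt x hl
  have h2 : HasFDerivAt (fun x : Eucl (d + 1) => 3 / 4 + Real.exp (-k * lastC x) / 4)
     ((1 / 4 : ℝ) • ((-k * Real.exp (-k * lastC x)) • lastL d)) x := by
    refine ((h1.const_mul (1 / 4)).const_add (3 / 4)).congr_of_eventuallyEq ?_
    filter_upwards with z
    simp only [Function.comp]; ring
  have h3 := (((hasFDerivAt_rh x).mul h2).add (hl.pow 2)).add (hl.const_mul (1 / 4))
  refine ⟨_, h3.congr_of_eventuallyEq ?_, ?_⟩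
  · filter_upwards with z
    simp only [hB]; simp; ring
  · intro w
    simp [lastL_apply]
    ring

/-- properties of the barrier g -/
structure BarG (d : ℕ) (θ Θ M C c1 : ℝ) (g : Eucl (d + 1) → ℝ) (G : Eucl (d + 1) → Eucl (d + 1))
    (H : Eucl (d + 1) → Matrix (Fin (d + 1)) (Fin (d + 1)) ℝ) : Prop where
  c2 : IsC2 g G H
  Cpos : 0 < C
  c1pos : 0 < c1
  le_one : ∀ x ∈ HB d, g x ≤ 1
  lat : ∀ x ∈ HB d, ‖x‖ ^ 2 = 3 / 4 → g x ≤ 0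
  half : ∀ x ∈ HB d, ‖x‖ < 1 / 2 → c1 ≤ g x
  rhs : ∀ x ∈ HB d, 0 < g x → rh x ≤ 2 / 3
  sub : ∀ x ∈ HB d, ∀ A, Ell θ Θ A → 0 < (A * H x).trace
  bd : ∀ x ∈ HB d, lastC x = 0 → 0 < g x → ∀ v : Eucl (d + 1), ‖v‖ ≤ M → M⁻¹ ≤ lastC v →
    -C * g x < ⟪v, G x⟫

set_option maxHeartbeats 1000000 in
lemma exists_barG (d : ℕ) {θ Θ M : ℝ} (hθ : 0 < θ) (hΘ : 0 < Θ) (hM : 1 ≤ M) :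
    ∃ C c1 g G H, BarG d θ Θ M C c1 g G H := by
  set k : ℝ := 4 + 32 * M ^ 2 with hk
  have hkpos : 0 < k := by positivity
  obtain ⟨Gh, Hh, h2⟩ := exists_isC2 (contDiff_hB d k)
  have hexp : ∀ x ∈ HB d, 0 < Real.exp (-k * lastC x) ∧ Real.exp (-k * lastC x) ≤ 1 := by
    intro x hx
    refine ⟨Real.exp_pos _, Real.exp_le_one_iff.2 ?_⟩
    have := mul_nonneg hkpos.le hx.1
    linarith
  have hG0 : ∀ x ∈ HB d, Gh x ≠ 0 := by
    intro x hx h0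
    obtain ⟨L, hL, hLw⟩ := hasFDerivAt_hB d k x
    have e1 : L (x - lastC x • eV d) = 0 := by rw [← h2.inner_eq hL, h0, inner_zero_right]
    have e2 : L (eV d) = 0 := by rw [← h2.inner_eq hL, h0, inner_zero_right]
    rw [hLw] at e1 e2
    rw [inner_sub_right, inner_smul_right, inner_eV, lastC_sub, lastC_smul, lastC_eV,
      real_inner_self_eq_norm_sq] at e1
    rw [inner_eV, lastC_eV] at e2
    have hrh : rh x = 0 := by
      have h4 : (3 / 4 + Real.exp (-k * lastC x) / 4) * (2 * rh x) = 0 := by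
        rw [← e1]; unfold rh; ring
      have := (hexp x hx).1
      have h3 : (3 / 4 + Real.exp (-k * lastC x) / 4) ≠ 0 := by positivity
      rcases mul_eq_zero.1 h4 with h | h
      · exact absurd h h3
      · linarith
    rw [hrh] at e2
    have := hx.1
    ring_nf at e2
    linarith
  obtain ⟨c, hc, hcl⟩ := exists_pos_lower (isCompact_HB d) (F := fun x => ‖Gh x‖ ^ 2)
    (by have := h2.contG; fun_prop) (fun x hx => by have := hG0 x hx; positivity)
  obtain ⟨S, hS, hSl⟩ := exists_upper (isCompact_HB d) (F := fun x => sabs (Hh x))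
    (continuous_sabs.comp h2.contH).continuousOn
  obtain ⟨N, hN, hNl⟩ := exists_upper (isCompact_HB d) (F := fun x => ‖Gh x‖)
    (by have := h2.contG; fun_prop)
  set α : ℝ := Θ * S / (θ * c) + 1 with hα
  have hαpos : 0 < α := by positivity
  have hαb : Θ * S < α * (θ * c) := by
    rw [hα, add_mul, div_mul_cancel₀ _ (by positivity)]; linarith [mul_pos hθ hc]
  clear_value α
  have hd4 : 0 < Real.exp (-α * (1 / 4)) - Real.exp (-α * (1 / 2)) :=
    sub_pos.2 (Real.exp_lt_exp.2 (by linarith))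
  have hd8 : 0 < Real.exp (-α * (3 / 8)) - Real.exp (-α * (1 / 2)) :=
    sub_pos.2 (Real.exp_lt_exp.2 (by linarith))
  set C : ℝ := α * (M * N) / (Real.exp (-α * (1 / 4)) - Real.exp (-α * (1 / 2))) + 1 with hC
  have hmono : ∀ a b : ℝ, a ≤ b → Real.exp (-α * b) ≤ Real.exp (-α * a) := fun a b hab =>
    Real.exp_le_exp.2 (by nlinarith)
  have hlt : ∀ z, 0 < Real.exp (-α * z) - Real.exp (-α * (1 / 2)) → z < 1 / 2 := by
    intro z hz
    by_contra hcon
    have := hmono _ _ (not_lt.1 hcon); linarith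
  have hc2 := h2.comp (G := fun z => Real.exp (-α * z) - Real.exp (-α * (1 / 2)))
    (G' := fun z => -α * Real.exp (-α * z)) (G'' := fun z => -α * (-α * Real.exp (-α * z)))
    (fun z => (hasDerivAt_expmul (-α) z).sub_const _)
    (fun z => (hasDerivAt_expmul (-α) z).const_mul _) (by fun_prop)
  have hh0 : ∀ x ∈ HB d, 3 / 4 * rh x + lastC x ^ 2 ≤ hB d k x := by
    intro x hx
    unfold hB
    have := rh_nonneg x
    have := (hexp x hx).1
    have := hx.1
    nlinarith [mul_nonneg (rh_nonneg x) (hexp x hx).1.le]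
  refine ⟨C, _, _, _, _, hc2, by positivity, hd8, ?_, ?_, ?_, ?_, ?_, ?_⟩
  · intro x hx
    have := hh0 x hx
    have := rh_nonneg x
    have h0 : 0 ≤ hB d k x := by nlinarith [sq_nonneg (lastC x)]
    have := hmono _ _ h0
    simp only [mul_zero, Real.exp_zero] at this
    linarith [Real.exp_pos (-α * (1 / 2))]
  · intro x hx hn
    have := hh0 x hx
    have : 1 / 2 ≤ hB d k x := by unfold rh at this; nlinarith [sq_nonneg (lastC x)]
    have := hmono _ _ this
    linarith
  · intro x hx hn
    have h1 : hB d k x ≤ 3 / 8 := by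
      unfold hB
      have a1 := mul_nonneg (rh_nonneg x) (sub_nonneg.2 (hexp x hx).2)
      have a2 : ‖x‖ ^ 2 ≤ 1 / 4 := by nlinarith [norm_nonneg x]
      have a3 := abs_lastC_le x
      have a4 : lastC x ≤ 1 / 2 := by nlinarith [hx.1]
      unfold rh at *
      linarith
    have := hmono _ _ h1
    linarith
  · intro x hx hg
    have := hlt _ hg
    have := hh0 x hx
    nlinarith [sq_nonneg (lastC x)]
  · intro x hx A hA
    have e : (A * (-α * Real.exp (-α * hB d k x)) • Hh x +
        A * (-α * (-α * Real.exp (-α * hB d k x))) • tens (Gh x) (Gh x)).trace =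
        (α * Real.exp (-α * hB d k x)) * (α * (A * tens (Gh x) (Gh x)).trace - (A * Hh x).trace) := by
      simp only [Matrix.trace_add, Matrix.mul_smul, Matrix.trace_smul, smul_eq_mul]; ring
    rw [Matrix.mul_add, e]
    have := hA.low (Gh x)
    have := (abs_le.1 (hA.trace_le (Hh x))).2
    have := hSl x hx
    have := hcl x hx
    have : 0 < α * (A * tens (Gh x) (Gh x)).trace - (A * Hh x).trace := by
      have b1 : θ * c ≤ (A * tens (Gh x) (Gh x)).trace := by nlinarith
      have b2 : Θ * sabs (Hh x) ≤ Θ * S := by gcongr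
      nlinarith
    positivity
  · intro x hx hy hg v hv hvn
    obtain ⟨L, hL, hLw⟩ := hasFDerivAt_hB d k x
    have hin : ⟪v, Gh x⟫ = L v := h2.inner_eq hL v
    rw [inner_smul_right]
    set E := Real.exp (-α * hB d k x) with hE
    have hEpos : 0 < E := Real.exp_pos _
    have hh : hB d k x = rh x := by simp [hB, hy]; ring
    have hCpos : 0 < C := by positivity
    by_cases hr : 1 / 4 ≤ rh x
    · have hneg : ⟪v, Gh x⟫ ≤ 0 := by
        rw [hin, hLw, hy]
        have a1 : ⟪x, v⟫ ≤ M := by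
          refine (real_inner_le_norm x v).trans ?_
          have : ‖x‖ ≤ 1 := by nlinarith [hx.2, norm_nonneg x]
          nlinarith [norm_nonneg v, norm_nonneg x]
        have a2 : M * M⁻¹ = 1 := mul_inv_cancel₀ (by positivity)
        have a3 : 1 ≤ M * lastC v := by rw [← a2]; gcongr
        have a4 : 0 < lastC v := lt_of_lt_of_le (by positivity) hvn
        have a5 : k / 16 ≤ rh x * k / 4 := by nlinarith
        simp only [mul_zero, Real.exp_zero]
        have a6 : (1 / 4 - rh x * k / 4) * lastC v ≤ (-(2 * M ^ 2)) * lastC v := by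
          gcongr; linarith
        have a7 : M ≤ M ^ 2 * lastC v := by nlinarith
        linarith
      have : 0 ≤ -α * E * ⟪v, Gh x⟫ := by
        have := mul_nonneg (mul_pos hαpos hEpos).le (neg_nonneg.2 hneg)
        linarith
      have := mul_pos hCpos hg
      linarith
    · have a1 : ⟪v, Gh x⟫ ≤ M * N := by
        refine (real_inner_le_norm _ _).trans ?_
        have := hNl x hx
        gcongr
      have a2 : E ≤ 1 := by
        have := hmono 0 (hB d k x) (by rw [hh]; exact rh_nonneg x)
        simp only [mul_zero, Real.exp_zero] at this
        exact this
      have a3 : Real.exp (-α * (1 / 4)) - Real.exp (-α * (1 / 2)) ≤ E - Real.exp (-α * (1 / 2)) := by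
        have := hmono (hB d k x) (1 / 4) (by rw [hh]; linarith)
        linarith
      have a4 : α * (M * N) < C * (E - Real.exp (-α * (1 / 2))) := by
        calc α * (M * N) < C * (Real.exp (-α * (1 / 4)) - Real.exp (-α * (1 / 2))) := by
              rw [hC, add_mul, div_mul_cancel₀ _ hd4.ne']; linarith
          _ ≤ _ := by gcongr
      have a5 : α * E * ⟪v, Gh x⟫ ≤ α * (M * N) := by
        have : α * E * ⟪v, Gh x⟫ ≤ α * E * (M * N) := by gcongr
        have : α * E * (M * N) ≤ α * 1 * (M * N) := by gcongr
        linarith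
      linarith


lemma expNegInvGlue_mono : Monotone expNegInvGlue := by
  intro a b hab
  rcases le_or_gt a 0 with h | h
  · rw [expNegInvGlue.zero_of_nonpos h]; exact expNegInvGlue.nonneg b
  · have hb : 0 < b := by linarith
    simp only [expNegInvGlue, not_le.2 h, not_le.2 hb, if_false]
    refine Real.exp_le_exp.2 ?_
    have := inv_anti₀ h hab
    linarith

/-- interior bump -/
noncomputable def fB (d : ℕ) (x : Eucl (d + 1)) : ℝ :=
  lastC x * (3 / 4 - ‖x‖ ^ 2) - expNegInvGlue (rh x - 2 / 3)

lemma contDiff_fB (d : ℕ) : ContDiff ℝ 2 (fB d) := by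
  unfold fB
  refine (contDiff_lastC.mul (contDiff_const.sub (contDiff_norm_sq ℝ))).sub ?_
  exact expNegInvGlue.contDiff.comp (contDiff_rh.sub contDiff_const)

lemma hasFDerivAt_fB (d : ℕ) (x : Eucl (d + 1)) : ∃ (L : Eucl (d + 1) →L[ℝ] ℝ) (q : ℝ),
    HasFDerivAt (fB d) L x ∧ 0 ≤ q ∧ (rh x ≤ 2 / 3 → q = 0) ∧ ∀ w, L w =
      lastC w * (3 / 4 - ‖x‖ ^ 2) - 2 * lastC x * ⟪x, w⟫
        - q * (2 * ⟪x, w⟫ - 2 * lastC x * lastC w) := by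
  have hl : HasFDerivAt (lastC : Eucl (d + 1) → ℝ) (lastL d) x := (lastL d).hasFDerivAt
  have h1 : HasFDerivAt (fun x : Eucl (d + 1) => ‖x‖ ^ 2) (2 • innerSL ℝ x) x :=
    (hasStrictFDerivAt_norm_sq x).hasFDerivAt
  have hp : HasDerivAt expNegInvGlue (deriv expNegInvGlue (rh x - 2 / 3)) (rh x - 2 / 3) :=
    ((expNegInvGlue.contDiff (n := 1)).differentiable (by norm_num) _).hasDerivAt
  have h2 := hp.comp_hasFDerivAt x ((hasFDerivAt_rh x).sub_const (2 / 3))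
  refine ⟨_, deriv expNegInvGlue (rh x - 2 / 3), (hl.mul (h1.const_sub (3 / 4))).sub h2,
    expNegInvGlue_mono.deriv_nonneg, ?_, ?_⟩
  · intro h
    have hmin : IsLocalMin expNegInvGlue (rh x - 2 / 3) := by
      filter_upwards with z
      rw [expNegInvGlue.zero_of_nonpos (by linarith)]
      exact expNegInvGlue.nonneg z
    exact hmin.deriv_eq_zero
  · intro w
    simp [lastL_apply]
    ring

/-- properties of the interior bump -/
structure BarF (d : ℕ) (r c2 S : ℝ) (f : Eucl (d + 1) → ℝ) (G : Eucl (d + 1) → Eucl (d + 1))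
    (H : Eucl (d + 1) → Matrix (Fin (d + 1)) (Fin (d + 1)) ℝ) : Prop where
  c2' : IsC2 f G H
  c2pos : 0 < c2
  Spos : 0 < S
  le : ∀ x ∈ HB d, f x ≤ 3 / 4
  lat : ∀ x ∈ HB d, ‖x‖ ^ 2 = 3 / 4 → f x ≤ 0
  bot : ∀ x ∈ HB d, lastC x = 0 → f x ≤ 0
  pos : ∀ x ∈ HB d, rh x ≤ 2 / 3 → 0 ≤ f x
  hess : ∀ x ∈ HB d, sabs (H x) ≤ S
  gr : ∀ x ∈ HB d, 0 ≤ f x → r ≤ ‖x - (1 / 2 : ℝ) • eV d‖ → c2 ≤ ‖G x‖ ^ 2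
  bd : ∀ x ∈ HB d, lastC x = 0 → rh x ≤ 2 / 3 → ∀ v : Eucl (d + 1), 0 ≤ lastC v →
    lastC v / 12 ≤ ⟪v, G x⟫

lemma exists_barF (d : ℕ) {r : ℝ} (hr : 0 < r) : ∃ c2 S f G H, BarF d r c2 S f G H := by
  obtain ⟨G, H, h2⟩ := exists_isC2 (contDiff_fB d)
  have hK : IsCompact (HB d ∩ {x | 0 ≤ fB d x ∧ r ≤ ‖x - (1 / 2 : ℝ) • eV d‖}) := by
    refine (isCompact_HB d).inter_right ?_
    exact (isClosed_le continuous_const h2.contF).inter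
      (isClosed_le (g := fun x => ‖x - (1 / 2 : ℝ) • eV d‖) continuous_const (by fun_prop))
  have hG0 : ∀ x ∈ (HB d ∩ {x | 0 ≤ fB d x ∧ r ≤ ‖x - (1 / 2 : ℝ) • eV d‖}), G x ≠ 0 := by
    rintro x ⟨hx, hf, hxr⟩ h0
    obtain ⟨L, q, hL, hq, hq0, hLw⟩ := hasFDerivAt_fB d x
    have e1 : L (x - lastC x • eV d) = 0 := by rw [← h2.inner_eq hL, h0, inner_zero_right]
    have e2 : L (eV d) = 0 := by rw [← h2.inner_eq hL, h0, inner_zero_right]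
    rw [hLw] at e1 e2
    rw [inner_sub_right, inner_smul_right, inner_eV, lastC_sub, lastC_smul, lastC_eV,
      real_inner_self_eq_norm_sq] at e1
    rw [inner_eV, lastC_eV] at e2
    have hy := hx.1
    have e3 : rh x * (lastC x + q) = 0 := by unfold rh; linarith
    rcases mul_eq_zero.1 e3 with h | h
    · have hn : ‖x‖ ^ 2 = lastC x ^ 2 := by unfold rh at h; linarith
      rw [hn] at e2
      have hy2 : lastC x = 1 / 2 := by nlinarith
      have : ‖x - (1 / 2 : ℝ) • eV d‖ ^ 2 = 0 := by
        rw [norm_sub_sq_real, inner_smul_right, inner_eV, norm_smul, norm_eV, hn, hy2]; norm_num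
      have : ‖x - (1 / 2 : ℝ) • eV d‖ = 0 := by simpa using this
      linarith
    · have hy0 : lastC x = 0 := by linarith
      have hρ : rh x ≤ 2 / 3 := by
        by_contra hcon
        have := expNegInvGlue.pos_of_pos (x := rh x - 2 / 3) (by linarith)
        unfold fB at hf
        rw [hy0] at hf; linarith
      rw [hq0 hρ, hy0] at e2
      unfold rh at hρ
      rw [hy0] at hρ
      linarith
  obtain ⟨c, hc, hcl⟩ := exists_pos_lower hK (F := fun x => ‖G x‖ ^ 2)
    (by have := h2.contG; fun_prop) (fun x hx => by have := hG0 x hx; positivity)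
  obtain ⟨S, hS, hSl⟩ := exists_upper (isCompact_HB d) (F := fun x => sabs (H x))
    (continuous_sabs.comp h2.contH).continuousOn
  refine ⟨c, S, fB d, G, H, h2, hc, hS, ?_, ?_, ?_, ?_, hSl, fun x hx h1 h3 => hcl x ⟨hx, h1, h3⟩, ?_⟩
  · intro x hx
    have h1 : lastC x ≤ 1 := by nlinarith [abs_lastC_le x, hx.2]
    have := expNegInvGlue.nonneg (rh x - 2 / 3)
    unfold fB
    nlinarith [hx.1, hx.2, sq_nonneg ‖x‖, mul_nonneg hx.1 (sq_nonneg ‖x‖)]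
  · intro x hx hn
    have := expNegInvGlue.nonneg (rh x - 2 / 3)
    unfold fB; rw [hn]; linarith
  · intro x hx hn
    have := expNegInvGlue.nonneg (rh x - 2 / 3)
    unfold fB; rw [hn]; linarith
  · intro x hx hn
    unfold fB
    rw [expNegInvGlue.zero_of_nonpos (by linarith)]
    have := mul_nonneg hx.1 (sub_nonneg.2 hx.2)
    linarith
  · intro x hx hy hn v hv
    obtain ⟨L, q, hL, hq, hq0, hLw⟩ := hasFDerivAt_fB d x
    rw [h2.inner_eq hL, hLw, hq0 hn, hy]
    unfold rh at hn
    rw [hy] at hn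
    nlinarith


lemma ParabolicTest.congr {n : ℕ} {D : Set (SpaceTime n)} {φ φt : SpaceTime n → ℝ}
    {g : SpaceTime n → Eucl n} {H : SpaceTime n → Matrix (Fin n) (Fin n) ℝ}
    {φ' φt' : SpaceTime n → ℝ}
    {g' : SpaceTime n → Eucl n} {H' : SpaceTime n → Matrix (Fin n) (Fin n) ℝ}
    (h : ParabolicTest φ D φt g H) (h1 : ∀ p, φ p = φ' p) (h2 : ∀ p, φt p = φt' p)
    (h3 : ∀ p, g p = g' p) (h4 : ∀ p, H p = H' p) : ParabolicTest φ' D φt' g' H' := by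
  rw [← funext h1, ← funext h2, ← funext h3, ← funext h4]; exact h

lemma tens_zero_right {n : ℕ} (a : Eucl n) : tens a 0 = 0 := by ext i j; simp [tens]
lemma tens_zero_left {n : ℕ} (a : Eucl n) : tens 0 a = 0 := by ext i j; simp [tens]
lemma tens_smul {n : ℕ} (c : ℝ) (a : Eucl n) : tens (c • a) (c • a) = (c ^ 2) • tens a a := by
  ext i j; simp [tens]; ring

/-- product of a time function and a test function -/
lemma ParabolicTest.timeMul {n : ℕ} {D : Set (SpaceTime n)} {φ φt : SpaceTime n → ℝ}
    {g : SpaceTime n → Eucl n} {H : SpaceTime n → Matrix (Fin n) (Fin n) ℝ}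
    {a a' : ℝ → ℝ} (ha : ∀ p ∈ D, HasDerivAt a (a' p.2) p.2)
    (ha' : ∀ p ∈ D, ContinuousAt a' p.2)
    (h : ParabolicTest φ D φt g H) :
    ParabolicTest (fun p => a p.2 * φ p) D (fun p => a' p.2 * φ p + a p.2 * φt p)
      (fun p => a p.2 • g p) (fun p => a p.2 • H p) := by
  refine ((ParabolicTest.time ha ha').mul h).congr (fun _ => rfl) (fun _ => rfl) ?_ ?_
  · intro p; simp
  · intro p; simp [tens_zero_right, tens_zero_left]

/-- inverse time -/
noncomputable def bet (B lam tk t : ℝ) : ℝ := B * lam / (t - tk)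

lemma hasDerivAt_bet {B lam tk t : ℝ} (hB : B * lam ≠ 0) (ht : tk < t) :
    HasDerivAt (bet B lam tk) (-(bet B lam tk t ^ 2 / (B * lam))) t := by
  have h1 : HasDerivAt (fun s => s - tk) 1 t := (hasDerivAt_id t).sub_const tk
  have hne : t - tk ≠ 0 := by linarith
  have := (hasDerivAt_const t (B * lam)).div h1 hne
  refine this.congr_deriv ?_
  unfold bet
  field_simp
  ring

/-- interior heat bump -/
noncomputable def psiB {d : ℕ} (f : Eucl (d + 1) → ℝ) (B lam tk : ℝ) (p : SpaceTime (d + 1)) : ℝ :=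
  Real.exp (-bet B lam tk p.2 * (1 - f p.1)) - Real.exp (-bet B lam tk p.2)

/-- boundary gain -/
noncomputable def sB (B lam tk t : ℝ) : ℝ := (t - tk) * Real.exp (-bet B lam tk t)

lemma psi_test {d : ℕ} {f : Eucl (d + 1) → ℝ} {G : Eucl (d + 1) → Eucl (d + 1)}
    {H : Eucl (d + 1) → Matrix (Fin (d + 1)) (Fin (d + 1)) ℝ} (h : IsC2 f G H)
    {B lam tk : ℝ} (hB : B * lam ≠ 0) :
    ParabolicTest (psiB f B lam tk) {q | tk < q.2}
      (fun p => bet B lam tk p.2 ^ 2 / (B * lam) *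
        ((1 - f p.1) * Real.exp (-bet B lam tk p.2 * (1 - f p.1)) - Real.exp (-bet B lam tk p.2)))
      (fun p => (Real.exp (-bet B lam tk p.2 * (1 - f p.1)) * bet B lam tk p.2) • G p.1)
      (fun p => Real.exp (-bet B lam tk p.2 * (1 - f p.1)) • (bet B lam tk p.2 • H p.1 +
        bet B lam tk p.2 ^ 2 • tens (G p.1) (G p.1))) := by
  have hd : ∀ p ∈ {q : SpaceTime (d + 1) | tk < q.2}, HasDerivAt (fun t => -bet B lam tk t)
      ((fun t => bet B lam tk t ^ 2 / (B * lam)) p.2) p.2 := by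
    intro p hp
    have := (hasDerivAt_bet hB hp).neg
    rw [neg_neg] at this
    exact this
  have hc : ∀ p ∈ {q : SpaceTime (d + 1) | tk < q.2},
      ContinuousAt (fun t => bet B lam tk t ^ 2 / (B * lam)) p.2 := by
    intro p hp
    exact ((hasDerivAt_bet hB hp).continuousAt.pow 2).div_const _
  have t1 := ParabolicTest.timeMul hd hc (((h.test {q : SpaceTime (d + 1) | tk < q.2}).cmul (-1)).addc 1)
  have e1 := t1.comp (G := Real.exp) (G' := Real.exp) (G'' := Real.exp) Real.hasDerivAt_exp
    Real.hasDerivAt_exp Real.continuous_exp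
  have e2 := (ParabolicTest.time hd hc).comp (G := Real.exp) (G' := Real.exp) (G'' := Real.exp)
    Real.hasDerivAt_exp Real.hasDerivAt_exp Real.continuous_exp
  have e3 : ∀ p : SpaceTime (d + 1), -bet B lam tk p.2 * (-1 * f p.1 + 1)
      = -bet B lam tk p.2 * (1 - f p.1) := fun p => by ring
  refine (e1.add (e2.cmul (-1))).congr ?_ ?_ ?_ ?_
  · intro p; simp only [psiB, e3]; ring
  · intro p; simp only [e3]; ring
  · intro p; simp only [e3, smul_zero, add_zero, smul_smul]; congr 1; ring
  · intro p
    simp only [e3, smul_zero, add_zero, smul_smul, tens_zero_left, tens_smul, smul_add]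
    congr 2 <;> ring

lemma exp_neg_le_inv {x : ℝ} (hx : 0 < x) : Real.exp (-x) ≤ 1 / x := by
  rw [Real.exp_neg, ← one_div]
  exact one_div_le_one_div_of_le hx (by linarith [Real.add_one_le_exp x])

lemma psiB_bound {d : ℕ} {f : Eucl (d + 1) → ℝ} {B lam tk : ℝ} (hB : 0 < B * lam)
    {p : SpaceTime (d + 1)} (hp : tk ≤ p.2) (hf : f p.1 ≤ 3 / 4) :
    |psiB f B lam tk p| ≤ 4 / (B * lam) * (p.2 - tk) := by
  rcases hp.eq_or_lt with h | h
  · simp [psiB, bet, ← h]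
  · have hpos : 0 < p.2 - tk := by linarith
    have hb : 0 < bet B lam tk p.2 := by unfold bet; positivity
    have key : Real.exp (-(bet B lam tk p.2 / 4)) ≤ 4 / (B * lam) * (p.2 - tk) := by
      refine (exp_neg_le_inv (by positivity)).trans (le_of_eq ?_)
      unfold bet; field_simp
    have e1 : Real.exp (-bet B lam tk p.2 * (1 - f p.1)) ≤ Real.exp (-(bet B lam tk p.2 / 4)) :=
      Real.exp_le_exp.2 (by nlinarith)
    have e2 : Real.exp (-bet B lam tk p.2) ≤ Real.exp (-(bet B lam tk p.2 / 4)) :=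
      Real.exp_le_exp.2 (by nlinarith)
    have := Real.exp_pos (-bet B lam tk p.2)
    have := Real.exp_pos (-bet B lam tk p.2 * (1 - f p.1))
    unfold psiB
    rw [abs_le]; constructor <;> linarith

lemma continuousOn_psiB {d : ℕ} {f : Eucl (d + 1) → ℝ} {G : Eucl (d + 1) → Eucl (d + 1)}
    {H : Eucl (d + 1) → Matrix (Fin (d + 1)) (Fin (d + 1)) ℝ} (h : IsC2 f G H)
    {B lam tk : ℝ} (hB : 0 < B * lam) {D : Set (SpaceTime (d + 1))}
    (hD : ∀ p ∈ D, tk ≤ p.2 ∧ f p.1 ≤ 3 / 4) : ContinuousOn (psiB f B lam tk) D := by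
  intro p hp
  rcases (hD p hp).1.eq_or_lt with h0 | h0
  · have hv : psiB f B lam tk p = 0 := by simp [psiB, bet, ← h0]
    unfold ContinuousWithinAt
    rw [hv]
    have hlim : Filter.Tendsto (fun q : SpaceTime (d + 1) => 4 / (B * lam) * (q.2 - tk))
        (nhdsWithin p D) (nhds 0) := by
      have : Continuous (fun q : SpaceTime (d + 1) => 4 / (B * lam) * (q.2 - tk)) := by fun_prop
      have := (this.tendsto p).mono_left (nhdsWithin_le_nhds (s := D))
      simpa [← h0] using this
    refine squeeze_zero_norm' ?_ hlim
    filter_upwards [self_mem_nhdsWithin] with q hq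
    exact psiB_bound hB (hD q hq).1 (hD q hq).2
  · have ho : IsOpen {q : SpaceTime (d + 1) | tk < q.2} := isOpen_lt continuous_const continuous_snd
    exact ((psi_test h hB.ne').contPhi.continuousAt (ho.mem_nhds h0)).continuousWithinAt

lemma sB_bound {B lam tk t : ℝ} (hB : 0 < B * lam) (ht : tk ≤ t) :
    0 ≤ sB B lam tk t ∧ sB B lam tk t ≤ t - tk := by
  have h0 : 0 ≤ t - tk := by linarith
  have : 0 ≤ bet B lam tk t := by unfold bet; positivity
  have e : Real.exp (-bet B lam tk t) ≤ 1 := Real.exp_le_one_iff.2 (by linarith)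
  unfold sB
  exact ⟨by positivity, mul_le_of_le_one_right h0 e⟩

lemma hasDerivAt_sB {B lam tk t : ℝ} (hB : B * lam ≠ 0) (ht : tk < t) :
    HasDerivAt (sB B lam tk) (Real.exp (-bet B lam tk t) * (1 + bet B lam tk t)) t := by
  have h1 : HasDerivAt (fun s => s - tk) 1 t := (hasDerivAt_id t).sub_const tk
  have := h1.mul (hasDerivAt_bet hB ht).neg.exp
  refine this.congr_deriv ?_
  have hne : t - tk ≠ 0 := by linarith
  have : (t - tk) * (bet B lam tk t ^ 2 / (B * lam)) = bet B lam tk t := by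
    unfold bet; field_simp
  simp only [neg_neg]
  linear_combination Real.exp (-bet B lam tk t) * this

lemma continuousOn_sB {B lam tk : ℝ} (hB : 0 < B * lam) : ContinuousOn (sB B lam tk) (Ici tk) := by
  intro t ht
  rcases (show tk ≤ t from ht).eq_or_lt with h0 | h0
  · have hv : sB B lam tk t = 0 := by simp [sB, ← h0]
    unfold ContinuousWithinAt
    rw [hv]
    have hlim : Filter.Tendsto (fun q : ℝ => q - tk) (nhdsWithin t (Ici tk)) (nhds 0) := by
      have : Continuous (fun q : ℝ => q - tk) := by fun_prop
      have := (this.tendsto t).mono_left (nhdsWithin_le_nhds (s := Ici tk))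
      simpa [← h0] using this
    refine squeeze_zero_norm' ?_ hlim
    filter_upwards [self_mem_nhdsWithin] with q hq
    have := sB_bound hB hq
    rw [Real.norm_eq_abs, abs_of_nonneg this.1]; exact this.2
  · exact (hasDerivAt_sB hB.ne' h0).continuousAt.continuousWithinAt


/-- the coefficients as used in the proof -/
structure Dat (d : ℕ) (lam θ Θ M : ℝ) (Q : ℝ → Matrix (Fin (d + 1)) (Fin (d + 1)) ℝ)
    (v : ℝ → Eucl (d + 1)) : Prop where
  lam_pos : 0 < lam
  lam_le : lam ≤ 1
  ell : ∀ t ∈ Icc (-1 : ℝ) 0, Ell θ Θ (Q t)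
  vb : ∀ t ∈ Icc (-1 : ℝ) 0, ‖v t‖ ≤ M
  vl : ∀ t ∈ Icc (-1 : ℝ) 0, M⁻¹ ≤ lastC (v t)

lemma sq_sqrt34 : (Real.sqrt (3 / 4)) ^ 2 = 3 / 4 := Real.sq_sqrt (by norm_num)

lemma sqrt34_lt : ‖(0 : Eucl (d + 1))‖ + Real.sqrt (3 / 4) < 1 := by
  rw [norm_zero, zero_add, Real.sqrt_lt' one_pos]; norm_num

lemma mem_Om_iff {d : ℕ} {ta tb : ℝ} {p : SpaceTime (d + 1)} :
    p ∈ Om d 0 (Real.sqrt (3 / 4)) ta tb ↔ p.1 ∈ HB d ∧ p.2 ∈ Icc ta tb := by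
  have : ‖p.1 - 0‖ ≤ Real.sqrt (3 / 4) ↔ ‖p.1‖ ^ 2 ≤ 3 / 4 := by
    rw [sub_zero, Real.le_sqrt (norm_nonneg _) (by norm_num)]
  simp only [Om, HB, Set.mem_ofPred_eq, this]
  tauto

lemma HB_KcP {d : ℕ} {x : Eucl (d + 1)} (hx : x ∈ HB d) {t : ℝ} (h1 : -1 < t) (h2 : t ≤ 0) :
    (x, t) ∈ KcP d 1 :=
  Om_sub sqrt34_lt h1 h2 (mem_Om_iff.2 ⟨hx, le_rfl, le_rfl⟩ : (x, t) ∈ Om d 0 _ t t)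

lemma propagate {d : ℕ} {lam θ Θ M C c1 : ℝ} {Q : ℝ → Matrix (Fin (d + 1)) (Fin (d + 1)) ℝ}
    {v : ℝ → Eucl (d + 1)} {g : Eucl (d + 1) → ℝ} {G : Eucl (d + 1) → Eucl (d + 1)}
    {H : Eucl (d + 1) → Matrix (Fin (d + 1)) (Fin (d + 1)) ℝ}
    (hD : Dat d lam θ Θ M Q v) (hg : BarG d θ Θ M C c1 g G H)
    {η : SpaceTime (d + 1) → ℝ} (hη : ObliqueSup d lam Q v η) (hpos : ∀ p ∈ KcP d 1, 0 ≤ η p)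
    {b ta tb : ℝ} (hb : 0 ≤ b) (hta : -1 < ta) (htb : tb ≤ 0)
    (hin : ∀ x ∈ HB d, b * Real.exp (-C * ta) * max (g x) 0 ≤ η (x, ta)) :
    ∀ x ∈ HB d, ∀ t ∈ Icc ta tb, b * Real.exp (-C * t) * max (g x) 0 ≤ η (x, t) := by
  rcases hb.eq_or_lt with h0 | hb
  · intro x hx t ht
    rw [← h0, zero_mul, zero_mul]
    exact hpos _ (HB_KcP hx (by linarith [ht.1]) (by linarith [ht.2]))
  have key := compare hη (c := 0) (r := Real.sqrt (3 / 4)) (ta := ta) (tb := tb) sqrt34_lt hta htb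
    (φ := fun p => b * Real.exp (-C * p.2) * max (g p.1) 0) ?_ ?_ ?_ ?_
  · intro x hx t ht
    exact key (x, t) (mem_Om_iff.2 ⟨hx, ht⟩)
  · have := hg.c2.contF
    fun_prop
  · intro p hp ht
    have := hin p.1 (mem_Om_iff.1 hp).1
    rw [← ht] at this
    exact this
  · intro p hp hr
    have hx := (mem_Om_iff.1 hp).1
    rw [sub_zero] at hr
    have := hg.lat p.1 hx (by rw [hr]; exact sq_sqrt34)
    simp only [max_eq_right this, mul_zero]
    exact hpos _ (Om_sub sqrt34_lt hta htb hp)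
  · intro p hp ht hr hlt
    obtain ⟨hx, htt⟩ := mem_Om_iff.1 hp
    have h0 := hpos _ (Om_sub sqrt34_lt hta htb hp)
    have htI : p.2 ∈ Icc (-1 : ℝ) 0 := ⟨by linarith, by linarith [htt.2]⟩
    have hgp : 0 < g p.1 := by
      by_contra hcon
      simp only [max_eq_right (not_lt.1 hcon), mul_zero] at hlt
      linarith
    have hE := Real.exp_pos (-C * p.2)
    refine ⟨_, _, _, _, ParabolicTest.timeMul (a := fun t => b * Real.exp (-C * t))
      (a' := fun t => b * (-C * Real.exp (-C * t)))
      (fun q _ => (hasDerivAt_expmul (-C) q.2).const_mul b)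
      (fun q _ => by fun_prop) (hg.c2.test _), ?_, ?_, ?_, ?_⟩
    · intro q _ _
      have := Real.exp_pos (-C * q.2)
      have := le_max_left (g q.1) 0
      gcongr
    · simp only [max_eq_left hgp.le]
    · intro _
      rw [Matrix.mul_smul, Matrix.trace_smul, smul_eq_mul]
      have h1 := hg.sub p.1 hx _ (hD.ell _ htI)
      have h2 : 0 < b * Real.exp (-C * p.2) * (Q p.2 * H p.1).trace := by positivity
      have h3 : 0 < lam * (b * (C * Real.exp (-C * p.2)) * g p.1) := by
        have := hD.lam_pos; have := hg.Cpos; positivity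
      linarith
    · intro hy
      rw [inner_smul_right]
      have h1 := hg.bd p.1 hx hy hgp _ (hD.vb _ htI) (hD.vl _ htI)
      have := mul_lt_mul_of_pos_left h1 (mul_pos hb hE)
      linarith

set_option maxHeartbeats 4000000 in
/-- one good time step -/
lemma good_step (d : ℕ) {θ Θ M C c1 r c2 S T : ℝ} (hθ : 0 < θ) (hΘ : 0 < Θ) (hM : 1 ≤ M)
    (hr : 0 < r) (hT : 0 < T) (hT1 : T ≤ 1)
    {g : Eucl (d + 1) → ℝ} {G : Eucl (d + 1) → Eucl (d + 1)}
    {H : Eucl (d + 1) → Matrix (Fin (d + 1)) (Fin (d + 1)) ℝ} (hg : BarG d θ Θ M C c1 g G H)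
    {f : Eucl (d + 1) → ℝ} {Gf : Eucl (d + 1) → Eucl (d + 1)}
    {Hf : Eucl (d + 1) → Matrix (Fin (d + 1)) (Fin (d + 1)) ℝ} (hf : BarF d r c2 S f Gf Hf) :
    ∃ δ > 0, ∀ (lam : ℝ) (Q : ℝ → Matrix (Fin (d + 1)) (Fin (d + 1)) ℝ) (v : ℝ → Eucl (d + 1))
      (η : SpaceTime (d + 1) → ℝ), Dat d lam θ Θ M Q v → ObliqueSup d lam Q v η →
      (∀ p ∈ KcP d 1, 0 ≤ η p) → ∀ b tk : ℝ, 0 ≤ b → b * Real.exp C ≤ 1 / 8 → -1 < tk →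
      tk + T * lam ≤ 0 →
      (∀ x, ‖x - (1 / 2 : ℝ) • eV d‖ ≤ r → ∀ t ∈ Icc tk (tk + T * lam), 1 / 4 ≤ η (x, t)) →
      (∀ x ∈ HB d, b * Real.exp (-C * tk) * max (g x) 0 ≤ η (x, tk)) →
      ∀ x ∈ HB d, (b + δ * lam) * Real.exp (-C * (tk + T * lam)) * max (g x) 0
        ≤ η (x, tk + T * lam) := by
  have hc2 := hf.c2pos
  have hS := hf.Spos
  have hCpos := hg.Cpos
  set B : ℝ := 1 + 2 * (Θ * S + 1) / (θ * c2) with hBd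
  have hB1 : 1 ≤ B := by rw [hBd]; have : 0 ≤ 2 * (Θ * S + 1) / (θ * c2) := by positivity
                         linarith
  have hB2 : 2 * (Θ * S + 1) ≤ B * (θ * c2) := by
    rw [hBd, add_mul, div_mul_cancel₀ _ (by positivity)]; linarith [mul_pos hθ hc2]
  clear_value B
  set κ : ℝ := 1 / 16 with hκ
  set δ' : ℝ := κ * Real.exp (-C) / (48 * M) with hδ'
  have hδpos : 0 < δ' := by rw [hδ', hκ]; positivity
  have hδe : Real.exp C * δ' = κ / (48 * M) := by
    rw [hδ', show Real.exp C * (κ * Real.exp (-C) / (48 * M)) =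
      (Real.exp C * Real.exp (-C)) * κ / (48 * M) by ring, ← Real.exp_add]; simp
  clear_value δ'
  refine ⟨δ' * (T * Real.exp (-(B / T))), by positivity, ?_⟩
  intro lam Q v η hD hη hpos b tk hb hbC htk htk1 hball hin
  have hlam := hD.lam_pos
  have hBl : 0 < B * lam := by positivity
  set A : ℝ → ℝ := fun t => Real.exp (-C * t) * (b + δ' * sB B lam tk t) with hA
  set A' : ℝ → ℝ := fun t => -C * Real.exp (-C * t) * (b + δ' * sB B lam tk t) +
    Real.exp (-C * t) * (δ' * (Real.exp (-bet B lam tk t) * (1 + bet B lam tk t))) with hA'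
  have hA0 : ∀ t, tk ≤ t → 0 ≤ A t := fun t ht => by
    have := (sB_bound hBl ht).1
    rw [hA]; positivity
  have hAd : ∀ t, tk < t → HasDerivAt A (A' t) t := fun t ht =>
    (hasDerivAt_expmul (-C) t).mul (((hasDerivAt_sB hBl.ne' ht).const_mul δ').const_add b)
  have hAc : ∀ t, tk < t → ContinuousAt A' t := fun t ht => by
    have h1 := (hasDerivAt_sB hBl.ne' ht).continuousAt
    have h2 := (hasDerivAt_bet hBl.ne' ht).continuousAt
    have h3 : ContinuousAt (fun t => Real.exp (-bet B lam tk t)) t := h2.neg.rexp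
    have h4 : ContinuousAt (fun t => Real.exp (-C * t)) t := by fun_prop
    rw [hA']
    exact ((continuousAt_const.mul h4).mul (continuousAt_const.add (continuousAt_const.mul h1))).add
      (h4.mul (continuousAt_const.mul (h3.mul (continuousAt_const.add h2))))
  have key := compare hη (c := 0) (r := Real.sqrt (3 / 4)) (ta := tk) (tb := tk + T * lam)
    sqrt34_lt htk htk1
    (φ := fun p => A p.2 * max (g p.1) 0 + κ * psiB f B lam tk p) ?_ ?_ ?_ ?_
  · intro x hx
    have h1 := key (x, tk + T * lam) (mem_Om_iff.2 ⟨hx, by constructor <;> simp <;> positivity⟩)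
    simp only [hA] at h1
    have hbe : bet B lam tk (tk + T * lam) = B / T := by
      unfold bet; rw [add_sub_cancel_left]; field_simp
    have hs : sB B lam tk (tk + T * lam) = T * lam * Real.exp (-(B / T)) := by
      unfold sB; rw [hbe, add_sub_cancel_left]
    rw [hs] at h1
    rcases le_or_gt (g x) 0 with h | h
    · rw [max_eq_right h, mul_zero]
      exact hpos _ (HB_KcP hx (by nlinarith) htk1)
    · have hf0 := hf.pos x hx (hg.rhs x hx h)
      have hψ : 0 ≤ psiB f B lam tk (x, tk + T * lam) := by
        unfold psiB
        rw [hbe]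
        refine sub_nonneg.2 (Real.exp_le_exp.2 ?_)
        have : 0 ≤ B / T := by positivity
        nlinarith
      refine le_trans (le_of_eq ?_) (le_trans (le_add_of_nonneg_right (mul_nonneg (by rw [hκ]; norm_num) hψ)) h1)
      ring
  · have h1 := hg.c2.contF
    refine ContinuousOn.add (ContinuousOn.mul ?_ (by fun_prop)) (ContinuousOn.mul continuousOn_const ?_)
    · have h2 : ContinuousOn (fun p : SpaceTime (d + 1) => sB B lam tk p.2)
        (Om d 0 (Real.sqrt (3 / 4)) tk (tk + T * lam)) :=
        (continuousOn_sB hBl).comp continuous_snd.continuousOn fun p hp => hp.2.2.1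
      simp only [hA]
      fun_prop
    · exact continuousOn_psiB hf.c2' hBl fun p hp =>
        ⟨hp.2.2.1, hf.le p.1 (mem_Om_iff.1 hp).1⟩
  · intro p hp ht
    have h1 := hin p.1 (mem_Om_iff.1 hp).1
    rw [← ht] at h1
    have h2 : sB B lam tk p.2 = 0 := by simp [sB, ht]
    have h3 : psiB f B lam tk p = 0 := by simp [psiB, bet, ht]
    simp only [hA, h2, h3, mul_zero, add_zero]
    rw [mul_comm (Real.exp _)]; exact h1
  · intro p hp hrr
    have hx := (mem_Om_iff.1 hp).1
    rw [sub_zero] at hrr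
    have hn : ‖p.1‖ ^ 2 = 3 / 4 := by rw [hrr]; exact sq_sqrt34
    have h1 := hg.lat p.1 hx hn
    have h2 := hf.lat p.1 hx hn
    have h3 : psiB f B lam tk p ≤ 0 := by
      unfold psiB
      refine sub_nonpos.2 (Real.exp_le_exp.2 ?_)
      have : 0 ≤ bet B lam tk p.2 := div_nonneg hBl.le (by linarith [hp.2.2.1])
      nlinarith
    simp only [max_eq_right h1, mul_zero, zero_add]
    have := hpos _ (Om_sub sqrt34_lt htk htk1 hp)
    have : κ * psiB f B lam tk p ≤ 0 := mul_nonpos_of_nonneg_of_nonpos (by rw [hκ]; norm_num) h3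
    linarith
  · intro p hp ht hrr hlt
    obtain ⟨hx, htt⟩ := mem_Om_iff.1 hp
    have h0 := hpos _ (Om_sub sqrt34_lt htk htk1 hp)
    have htI : p.2 ∈ Icc (-1 : ℝ) 0 := ⟨by linarith, by linarith [htt.2]⟩
    have hQ := hD.ell _ htI
    have hu : 0 < p.2 - tk := by linarith
    have huT : p.2 - tk ≤ T * lam := by linarith [htt.2]
    have hκp : 0 < κ := by rw [hκ]; norm_num
    set β := bet B lam tk p.2 with hβ
    have hβB : B ≤ β := by
      rw [hβ, bet, le_div_iff₀ hu]
      have : T * lam ≤ 1 * lam := by gcongr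
      have : p.2 - tk ≤ lam := by linarith
      gcongr
    have hβ1 : 1 ≤ β := hB1.trans hβB
    set e1 := Real.exp (-β * (1 - f p.1)) with he1
    set e2 := Real.exp (-β) with he2
    have he1p : 0 < e1 := Real.exp_pos _
    have he2p : 0 < e2 := Real.exp_pos _
    have hψ : psiB f B lam tk p = e1 - e2 := rfl
    have hf34 := hf.le p.1 hx
    have he1l : e1 ≤ 1 := Real.exp_le_one_iff.2 (by
      have := mul_nonneg (by linarith : 0 ≤ β) (by linarith : 0 ≤ 1 - f p.1)
      linarith)
    have hEC : Real.exp (-C * p.2) ≤ Real.exp C := Real.exp_le_exp.2 (by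
      have := mul_nonneg hCpos.le (by linarith [htI.1] : 0 ≤ p.2 + 1)
      linarith)
    have hEp := Real.exp_pos (-C * p.2)
    obtain ⟨hs0, hs1⟩ := sB_bound hBl htt.1
    have hA0p := hA0 p.2 htt.1
    have hδM : κ / (48 * M) ≤ κ / 48 := by
      apply div_le_div_of_nonneg_left hκp.le (by norm_num); linarith
    have hAle : A p.2 ≤ 1 / 8 + κ / 48 := by
      have : p.2 - tk ≤ 1 := by linarith [mul_le_one₀ hT1 hlam.le hD.lam_le]
      calc A p.2 ≤ Real.exp C * (b + δ' * 1) := by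
            simp only [hA]
            have : δ' * sB B lam tk p.2 ≤ δ' * 1 := by gcongr; linarith
            gcongr
        _ = b * Real.exp C + Real.exp C * δ' := by ring
        _ ≤ _ := by rw [hδe]; linarith
    have hgm : max (g p.1) 0 ≤ 1 := max_le (hg.le_one _ hx) zero_le_one
    have hout : r ≤ ‖p.1 - (1 / 2 : ℝ) • eV d‖ := by
      by_contra hcon
      have h1 := hball p.1 (not_le.1 hcon).le p.2 htt
      have h2 : A p.2 * max (g p.1) 0 ≤ A p.2 * 1 := by gcongr
      have h3 : κ * psiB f B lam tk p ≤ κ * 1 := by gcongr; rw [hψ]; linarith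
      have h4 : η p = η (p.1, p.2) := rfl
      rw [hκ] at *
      linarith
    -- main interior inequality
    have hint : 0 ≤ f p.1 →
        lam * (β ^ 2 / (B * lam) * ((1 - f p.1) * e1 - e2)) + 2 * β * e2 * (1 / 2) ≤
        (Q p.2 * e1 • (β • Hf p.1 + β ^ 2 • tens (Gf p.1) (Gf p.1))).trace := by
      intro hf0
      have t1 : (Q p.2 * e1 • (β • Hf p.1 + β ^ 2 • tens (Gf p.1) (Gf p.1))).trace =
          e1 * (β * (Q p.2 * Hf p.1).trace + β ^ 2 * (Q p.2 * tens (Gf p.1) (Gf p.1)).trace) := by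
        simp only [Matrix.mul_smul, Matrix.mul_add, Matrix.trace_smul, Matrix.trace_add, smul_eq_mul]
      have t2 := hQ.low (Gf p.1)
      have t3 := (abs_le.1 (hQ.trace_le (Hf p.1))).1
      have t4 : Θ * sabs (Hf p.1) ≤ Θ * S := by have := hf.hess p.1 hx; gcongr
      have t5 : θ * c2 ≤ θ * ‖Gf p.1‖ ^ 2 := by have := hf.gr p.1 hx hf0 hout; gcongr
      have t6 : e2 ≤ e1 := Real.exp_le_exp.2 (by
        have := mul_nonneg (by linarith : 0 ≤ β) hf0
        linarith)
      rw [t1]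
      have t7 : lam * (β ^ 2 / (B * lam) * ((1 - f p.1) * e1 - e2)) ≤ e1 * (β ^ 2 / B) := by
        have e : lam * (β ^ 2 / (B * lam) * ((1 - f p.1) * e1 - e2)) =
          (β ^ 2 / B) * ((1 - f p.1) * e1 - e2) := by field_simp
        rw [e, mul_comm e1]
        gcongr
        have := mul_nonneg hf0 he1p.le
        linarith
      have hB0 : 0 < B := by linarith
      have t8 : β ^ 2 / B ≤ β ^ 2 * (θ * c2 / 2) := by
        rw [div_le_iff₀ hB0]
        have : 1 ≤ θ * c2 / 2 * B := by linarith [mul_pos hΘ hS]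
        have := mul_le_mul_of_nonneg_left this (sq_nonneg β)
        linarith
      have t9 : e1 * (β * (-(Θ * S)) + β ^ 2 * (θ * c2)) ≤
          e1 * (β * (Q p.2 * Hf p.1).trace + β ^ 2 * (Q p.2 * tens (Gf p.1) (Gf p.1)).trace) := by
        gcongr <;> linarith
      have t10 : β ^ 2 / B + β ≤ β * (-(Θ * S)) + β ^ 2 * (θ * c2) := by
        have : β * (Θ * S + 1) ≤ β * (β * (θ * c2) / 2) := by
          have : B * (θ * c2) ≤ β * (θ * c2) := by gcongr
          gcongr; linarith
        linarith
      have t11 : e1 * (β ^ 2 / B + β) ≤ e1 * (β * (-(Θ * S)) + β ^ 2 * (θ * c2)) := by gcongr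
      have t12 : β * e2 ≤ β * e1 := by gcongr
      linarith
    have hψT := (psi_test hf.c2' (B := B) (lam := lam) (tk := tk) hBl.ne').cmul κ
    rcases le_or_gt (g p.1) 0 with hgn | hgp
    · -- only the interior bump is active
      simp only [max_eq_right hgn, mul_zero, zero_add] at hlt
      have hψp : 0 < e1 - e2 := by
        rw [← hψ]
        by_contra hcon
        have := mul_nonpos_of_nonneg_of_nonpos hκp.le (not_lt.1 hcon)
        linarith
      have hfp : 0 < f p.1 := by
        by_contra hcon
        have : e1 ≤ e2 := Real.exp_le_exp.2 (by
          have := mul_nonneg (by linarith : 0 ≤ β) (by linarith : 0 ≤ -f p.1)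
          linarith)
        linarith
      refine ⟨_, _, _, _, hψT, ?_, ?_, ?_, ?_⟩
      · intro q hq hq2
        have := mul_nonneg (hA0 q.2 hq2.le) (le_max_right (g q.1) 0)
        linarith
      · simp only [max_eq_right hgn, mul_zero, zero_add]
      · intro _
        have := hint hfp.le
        rw [Matrix.mul_smul, Matrix.trace_smul, smul_eq_mul]
        have h3 : 0 < β * e2 := by positivity
        have h5 := mul_lt_mul_of_pos_left (lt_of_lt_of_le (lt_add_of_pos_right
          (lam * (β ^ 2 / (B * lam) * ((1 - f p.1) * e1 - e2)))
          (show 0 < 2 * β * e2 * (1 / 2) by linarith)) this) hκp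
        calc _ = κ * (lam * (β ^ 2 / (B * lam) * ((1 - f p.1) * e1 - e2))) := by ring
          _ < _ := h5
      · intro hy
        have := hf.bot p.1 hx hy
        linarith
    · have hf0 := hf.pos p.1 hx (hg.rhs _ hx hgp)
      have hg1 := hg.le_one _ hx
      have hδb : Real.exp (-C * p.2) * (δ' * (e2 * (1 + β))) * g p.1 ≤ κ / (24 * M) * (β * e2) := by
        have i1 : Real.exp (-C * p.2) * (δ' * (e2 * (1 + β))) * g p.1 ≤
            Real.exp C * (δ' * (e2 * (β + β))) * 1 := by gcongr
        have i2 : Real.exp C * (δ' * (e2 * (β + β))) * 1 = (Real.exp C * δ') * (2 * (β * e2)) := by ring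
        rw [i2, hδe] at i1
        refine i1.trans (le_of_eq ?_)
        field_simp; norm_num
      have hβe : 0 < β * e2 := by positivity
      refine ⟨_, _, _, _, (ParabolicTest.timeMul (fun q hq => hAd q.2 hq) (fun q hq => hAc q.2 hq)
        (hg.c2.test {q : SpaceTime (d + 1) | tk < q.2})).add hψT, ?_, ?_, ?_, ?_⟩
      · intro q hq hq2
        have := mul_le_mul_of_nonneg_left (le_max_left (g q.1) 0) (hA0 q.2 hq2.le)
        linarith
      · simp only [max_eq_left hgp.le]
      · intro _
        have i0 := hint hf0
        have i1 := mul_nonneg hA0p (hg.sub p.1 hx _ hQ).le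
        rw [Matrix.mul_add, Matrix.trace_add, Matrix.mul_smul, Matrix.trace_smul, smul_eq_mul,
          Matrix.mul_smul _ κ, Matrix.trace_smul, smul_eq_mul]
        have i2 := mul_le_mul_of_nonneg_left i0 hκp.le
        have i3 : A' p.2 * g p.1 ≤ κ / (24 * M) * (β * e2) := by
          have : A' p.2 = -(C * A p.2) + Real.exp (-C * p.2) * (δ' * (e2 * (1 + β))) := by
            simp only [hA', hA]; ring
          rw [this]
          have : 0 ≤ C * A p.2 * g p.1 := by positivity
          linarith
        have i4 : κ / (24 * M) ≤ κ / 24 := by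
          apply div_le_div_of_nonneg_left hκp.le (by norm_num); linarith
        have i5 : lam * (A' p.2 * g p.1) ≤ κ / 24 * (β * e2) := by
          have j1 : lam * (A' p.2 * g p.1) ≤ lam * (κ / 24 * (β * e2)) := by
            exact mul_le_mul_of_nonneg_left (i3.trans (mul_le_mul_of_nonneg_right i4 hβe.le)) hlam.le
          have j2 : lam * (κ / 24 * (β * e2)) ≤ 1 * (κ / 24 * (β * e2)) := by
            gcongr; exact hD.lam_le
          linarith
        have i6 : κ / 24 * (β * e2) < κ * (2 * β * e2 * (1 / 2)) := by nlinarith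
        simp only [mul_zero, add_zero]
        linarith
      · intro hy
        have hf1 : f p.1 = 0 := le_antisymm (hf.bot _ hx hy) hf0
        have hee : e1 = e2 := by rw [he1, he2, hf1]; congr 1; ring
        have hvl := hD.vl _ htI
        have hMi : 0 < M⁻¹ := by positivity
        have b1 := hf.bd p.1 hx hy (hg.rhs _ hx hgp) (v p.2) (by linarith)
        have b2 := hg.bd p.1 hx hy hgp _ (hD.vb _ htI) hvl
        have b3 := mul_le_mul_of_nonneg_left b2.le hA0p
        rw [inner_add_right, inner_smul_right, inner_smul_right, inner_smul_right]
        have i3 : A' p.2 * g p.1 ≤ A p.2 * (-C * g p.1) + κ / (24 * M) * (β * e2) := by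
          have : A' p.2 = -(C * A p.2) + Real.exp (-C * p.2) * (δ' * (e2 * (1 + β))) := by
            simp only [hA', hA]; ring
          rw [this]
          linarith
        have i4 : κ / (24 * M) * (β * e2) < κ * (e1 * β * ⟪v p.2, Gf p.1⟫) := by
          have : κ / (24 * M) * (β * e2) = κ * (e2 * β * (M⁻¹ / 24)) := by field_simp
          rw [this, hee]
          have : M⁻¹ / 24 < ⟪v p.2, Gf p.1⟫ := by linarith
          gcongr
        have i5 : β ^ 2 / (B * lam) * ((1 - f p.1) * e1 - e2) = 0 := by rw [hf1, hee]; ring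
        simp only [mul_zero, add_zero]
        rw [i5]
        have goal : A' p.2 * g p.1 + κ * 0 < A p.2 * ⟪v p.2, G p.1⟫ + κ * (e1 * β * ⟪v p.2, Gf p.1⟫) := by
          rw [mul_zero, add_zero]
          exact i3.trans_lt (add_lt_add_of_le_of_lt b3 i4)
        exact goal


/-- frequency vector -/
noncomputable def xiV {n : ℕ} (k : Fin n → ℤ) : Eucl n :=
  WithLp.toLp 2 (fun i => 2 * Real.pi * (k i : ℝ))

/-- real part of `c e^{is}` -/
noncomputable def csF (c : ℂ) (s : ℝ) : ℝ := c.re * Real.cos s - c.im * Real.sin s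

lemma csF_eq (c : ℂ) (s : ℝ) : csF c s = (c * Complex.exp (s * Complex.I)).re := by
  rw [Complex.mul_re, Complex.exp_ofReal_mul_I_re, Complex.exp_ofReal_mul_I_im, csF]

lemma abs_csF_le (c : ℂ) (s : ℝ) : |csF c s| ≤ ‖c‖ := by
  rw [csF_eq]
  refine (Complex.abs_re_le_norm _).trans ?_
  rw [norm_mul, Complex.norm_exp_ofReal_mul_I, mul_one]

lemma hasDerivAt_csF (c : ℂ) (s : ℝ) : HasDerivAt (csF c) (csF (Complex.I * c) s) s := by
  have := ((Real.hasDerivAt_cos s).const_mul c.re).sub ((Real.hasDerivAt_sin s).const_mul c.im)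
  refine this.congr_deriv ?_
  simp [csF]; ring

lemma csF_I_I (c : ℂ) (s : ℝ) : csF (Complex.I * (Complex.I * c)) s = - csF c s := by
  rw [← mul_assoc, Complex.I_mul_I]; simp [csF]; ring

lemma continuous_csF (c : ℂ) : Continuous (csF c) := by unfold csF; fun_prop

/-- quotient map to the torus -/
noncomputable def toT {n : ℕ} (x : Eucl n) : UnitAddTorus (Fin n) := fun i => (x i : UnitAddCircle)

lemma continuous_toT {n : ℕ} : Continuous (toT : Eucl n → UnitAddTorus (Fin n)) := by
  refine continuous_pi fun i => ?_
  exact (AddCircle.continuous_mk' 1).comp (by fun_prop : Continuous fun x : Eucl n => x i)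

lemma mFourier_toT {n : ℕ} (k : Fin n → ℤ) (x : Eucl n) :
    UnitAddTorus.mFourier k (toT x) = Complex.exp ((⟪xiV k, x⟫ : ℝ) * Complex.I) := by
  simp only [UnitAddTorus.mFourier, ContinuousMap.coe_mk, toT]
  rw [Finset.prod_congr rfl (fun i _ => fourier_coe_apply (T := 1)), ← Complex.exp_sum]
  congr 1
  rw [inner_sum', xiV]
  push_cast
  rw [Finset.sum_mul]
  refine Finset.sum_congr rfl fun i _ => ?_
  simp; ring

lemma toT_injOn {n : ℕ} (c : Eucl n) : InjOn (toT : Eucl n → UnitAddTorus (Fin n)) (closedBall c (1/4)) := by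
  intro x hx y hy h
  ext i
  have hi : ((x i : ℝ) : UnitAddCircle) = (y i : ℝ) := congrFun h i
  have h1 : |x i - y i| ≤ 1 / 2 := by
    have e1 : |(x - y) i| ≤ ‖x - y‖ := by
      simpa [Real.norm_eq_abs] using PiLp.norm_apply_le (x - y) i
    have e2 : ‖x - y‖ ≤ 1/4 + 1/4 := by
      rw [← dist_eq_norm]
      exact (dist_triangle_right x y c).trans (add_le_add (mem_closedBall.1 hx) (mem_closedBall.1 hy))
    simp only [PiLp.sub_apply] at e1
    linarith
  rw [QuotientAddGroup.eq] at hi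
  obtain ⟨m, hm⟩ := AddSubgroup.mem_zmultiples_iff.1 hi
  simp only [zsmul_eq_mul, mul_one] at hm
  have : m = 0 := by
    have h2 : |(m : ℝ)| < 1 := by
      rw [hm, show -x i + y i = -(x i - y i) by ring, abs_neg]; linarith
    exact_mod_cast Int.abs_lt_one_iff.1 (by exact_mod_cast h2)
  rw [this] at hm
  push_cast at hm; linarith

section
attribute [local instance] instMeasureSpaceUnitAddCircle
lemma coef_bound {n : ℕ} {P : C(UnitAddTorus (Fin n), ℂ)} (c : (Fin n → ℤ) →₀ ℂ)
    (hc : (c.sum fun i a => a • UnitAddTorus.mFourier i) = P) (k : Fin n → ℤ) : ‖c k‖ ≤ ‖P‖ := by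
  have : IsProbabilityMeasure (volume : Measure UnitAddCircle) :=
    inferInstanceAs (IsProbabilityMeasure AddCircle.haarAddCircle)
  have h1 := (UnitAddTorus.orthonormal_mFourier (d := Fin n)).inner_right_finsupp c k
  have h2 : Finsupp.linearCombination ℂ (UnitAddTorus.mFourierLp (d := Fin n) 2) c
      = ContinuousMap.toLp (E := ℂ) 2 volume ℂ P := by
    rw [← hc, Finsupp.linearCombination_apply, Finsupp.sum, Finsupp.sum, map_sum]
    refine Finset.sum_congr rfl fun k _ => ?_
    rw [map_smul]
  rw [h2] at h1
  rw [← h1]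
  refine (norm_inner_le_norm _ _).trans ?_
  rw [(UnitAddTorus.orthonormal_mFourier (d := Fin n)).1 k, one_mul]
  refine (ContinuousLinearMap.le_opNorm _ _).trans ?_
  have h3 : ‖(ContinuousMap.toLp (E := ℂ) 2 (volume : Measure (UnitAddTorus (Fin n))) ℂ)‖ ≤ 1 := by
    refine (ContinuousMap.toLp_norm_le _ ).trans ?_
    have : measureUnivNNReal (volume : Measure (UnitAddTorus (Fin n))) = 1 := by
      simp [measureUnivNNReal]
    rw [this]; simp
  calc _ ≤ 1 * ‖P‖ := by gcongr
    _ = _ := one_mul _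
end

lemma trig_approx {n : ℕ} (x0 : Eucl n) {f : Eucl n → ℝ} (hf : ContinuousOn f (closedBall x0 (1/4)))
    (hf01 : ∀ x ∈ closedBall x0 (1/4), f x ∈ Icc (0:ℝ) 1) {ε : ℝ} (hε : 0 < ε) :
    ∃ (S : Finset (Fin n → ℤ)) (c : (Fin n → ℤ) → ℂ), (∀ k ∈ S, ‖c k‖ ≤ 1 + ε) ∧
      (∀ x, (∑ k ∈ S, csF (c k) ⟪xiV k, x⟫) ∈ Icc (-ε) (1 + ε)) ∧
      ∀ x ∈ closedBall x0 (1/4), |(∑ k ∈ S, csF (c k) ⟪xiV k, x⟫) - f x| ≤ ε := by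
  classical
  let e : closedBall x0 (1/4 : ℝ) → UnitAddTorus (Fin n) := fun x => toT x.1
  have : CompactSpace (closedBall x0 (1/4 : ℝ)) :=
    isCompact_iff_compactSpace.1 (isCompact_closedBall x0 (1/4 : ℝ))
  have he : Topology.IsClosedEmbedding e :=
    (continuous_toT.comp continuous_subtype_val).isClosedEmbedding
      (fun x y h => Subtype.ext (toT_injOn x0 x.2 y.2 h))
  obtain ⟨g, hg, hge⟩ := ContinuousMap.exists_extension_forall_mem_of_isClosedEmbedding
    (⟨_, continuousOn_iff_continuous_domRestrict.1 hf⟩ : C(closedBall x0 (1/4 : ℝ), ℝ)) (t := Icc 0 1)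
    (fun x => hf01 x.1 x.2) ⟨0, by norm_num⟩ he
  let gc : C(UnitAddTorus (Fin n), ℂ) := ⟨fun y => (g y : ℂ), by fun_prop⟩
  have hgc : gc ∈ (Submodule.span ℂ (range <| UnitAddTorus.mFourier (d := Fin n))).topologicalClosure := by
    rw [UnitAddTorus.span_mFourier_closure_eq_top]; trivial
  obtain ⟨P, hP, hPd⟩ := Metric.mem_closure_iff.1 hgc ε hε
  obtain ⟨c, hc⟩ := (Finsupp.mem_span_range_iff_exists_finsupp).1 hP
  have hgn : ‖gc‖ ≤ 1 := by
    refine (ContinuousMap.norm_le _ zero_le_one).2 fun y => ?_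
    show ‖(g y : ℂ)‖ ≤ 1
    rw [Complex.norm_real, Real.norm_eq_abs, abs_le]
    constructor <;> linarith [(hg y).1, (hg y).2]
  have hPn : ‖P‖ ≤ 1 + ε := by
    have : ‖P‖ ≤ ‖gc‖ + ‖gc - P‖ := by
      have := norm_sub_le gc (gc - P); simpa using this
    rw [dist_eq_norm] at hPd
    linarith
  have key : ∀ x, (∑ k ∈ c.support, csF (c k) ⟪xiV k, x⟫) = (P (toT x)).re := fun x => by
    rw [← hc, Finsupp.sum, ContinuousMap.coe_sum, Finset.sum_apply, Complex.re_sum]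
    refine Finset.sum_congr rfl fun k _ => ?_
    rw [csF_eq, ← mFourier_toT]; rfl
  have hd : ∀ y, |(P y).re - g y| ≤ ε := fun y => by
    have h1 : ‖(gc - P) y‖ ≤ ‖gc - P‖ := ContinuousMap.norm_coe_le_norm _ y
    rw [dist_eq_norm] at hPd
    have h2 := Complex.abs_re_le_norm ((gc - P) y)
    have h3 : ((gc - P) y).re = g y - (P y).re := by simp [gc]
    rw [h3, abs_sub_comm] at h2
    linarith
  refine ⟨c.support, c, fun k _ => ?_, fun x => ?_, fun x hx => ?_⟩
  · exact (coef_bound c hc k).trans hPn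
  · rw [key]
    have h1 := abs_le.1 (hd (toT x))
    constructor <;> linarith [(hg (toT x)).1, (hg (toT x)).2]
  · rw [key]
    have : g (toT x) = f x := congrFun hge ⟨x, hx⟩
    rw [← this]; exact hd _

open ProbabilityTheory in
lemma gauss_bound {n : ℕ} {S : Finset (Fin n → ℤ)} {c : (Fin n → ℤ) → ℂ} {a b : ℝ}
    (hb : ∀ x, (∑ k ∈ S, csF (c k) ⟪xiV k, x⟫) ∈ Icc a b) {A : Matrix (Fin n) (Fin n) ℝ}
    (hA : A.PosSemidef) (x : Eucl n) :
    (∑ k ∈ S, Real.exp (-((A * tens (xiV k) (xiV k)).trace / 2)) * csF (c k) ⟪xiV k, x⟫) ∈ Icc a b := by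
  have hchar : ∀ ξ : Eucl n, ∫ z, Complex.exp ((⟪z, ξ⟫ : ℝ) * Complex.I) ∂(multivariateGaussian 0 A)
      = (Real.exp (-((A * tens ξ ξ).trace / 2)) : ℝ) := fun ξ => by
    have := charFun_multivariateGaussian (μ := (0 : Eucl n)) hA ξ
    rw [charFun_apply] at this
    rw [this, inner_zero_right, Complex.ofReal_exp]
    congr 1
    rw [trace_tens]
    simp [dotProduct, Matrix.mulVec, Finset.mul_sum, mul_assoc]
  have hint : ∀ (k : Fin n → ℤ), Integrable (fun z : Eucl n => c k * Complex.exp ((⟪xiV k, x⟫ : ℝ) * Complex.I)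
      * Complex.exp ((⟪z, xiV k⟫ : ℝ) * Complex.I)) (multivariateGaussian 0 A) := fun k => by
    refine Integrable.const_mul ?_ _
    refine Integrable.of_bound (C := 1) (by fun_prop) ?_
    refine Filter.Eventually.of_forall fun z => ?_
    rw [Complex.norm_exp_ofReal_mul_I]
  have hre : ∀ k z, csF (c k) ⟪xiV k, x + z⟫ = (c k * Complex.exp ((⟪xiV k, x⟫ : ℝ) * Complex.I)
      * Complex.exp ((⟪z, xiV k⟫ : ℝ) * Complex.I)).re := fun k z => by
    rw [csF_eq, mul_assoc, ← Complex.exp_add, inner_add_right, real_inner_comm (xiV k) z]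
    congr 3; push_cast; ring
  have hintr : ∀ k : Fin n → ℤ, Integrable (fun z : Eucl n => csF (c k) ⟪xiV k, x + z⟫) (multivariateGaussian 0 A) :=
    fun k => by
      simp only [hre]; exact (hint k).re
  have key : (∑ k ∈ S, Real.exp (-((A * tens (xiV k) (xiV k)).trace / 2)) * csF (c k) ⟪xiV k, x⟫)
      = ∫ z, (∑ k ∈ S, csF (c k) ⟪xiV k, x + z⟫) ∂(multivariateGaussian 0 A) := by
    rw [integral_finsetSum _ (fun k _ => hintr k)]
    refine Finset.sum_congr rfl fun k _ => ?_
    simp only [hre]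
    have := integral_re (hint k)
    simp only [RCLike.re_eq_complex_re] at this
    rw [this, integral_const_mul, hchar, csF_eq, mul_comm _ (((Real.exp _ : ℝ)) : ℂ), Complex.re_ofReal_mul]
  rw [key]
  have hI : Integrable (fun z : Eucl n => ∑ k ∈ S, csF (c k) ⟪xiV k, x + z⟫) (multivariateGaussian 0 A) :=
    integrable_finsetSum _ (fun k _ => hintr k)
  constructor
  · have := integral_mono (integrable_const a) hI (fun z => (hb (x + z)).1)
    simpa using this
  · have := integral_mono hI (integrable_const b) (fun z => (hb (x + z)).2)
    simpa using this


/-- clip to `[-1,0]` -/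
noncomputable def clp (t : ℝ) : ℝ := max (-1) (min t 0)
lemma clp_mem (t : ℝ) : clp t ∈ Icc (-1 : ℝ) 0 :=
  ⟨le_max_left _ _, max_le (by norm_num) (min_le_right _ _)⟩
lemma clp_eq {t : ℝ} (h : t ∈ Icc (-1 : ℝ) 0) : clp t = t := by
  rw [clp, min_eq_left h.2, max_eq_right h.1]
lemma continuous_clp : Continuous clp := by unfold clp; fun_prop

/-- exponent rate -/
noncomputable def qF {n : ℕ} (Q : ℝ → Matrix (Fin n) (Fin n) ℝ) (k : Fin n → ℤ) (t : ℝ) : ℝ :=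
  (Q (clp t) * tens (xiV k) (xiV k)).trace

/-- exponent -/
noncomputable def eF {n : ℕ} (Q : ℝ → Matrix (Fin n) (Fin n) ℝ) (lam t0 : ℝ) (k : Fin n → ℤ)
    (t : ℝ) : ℝ := lam⁻¹ * ∫ s in t0..t, qF Q k s

/-- explicit solution -/
noncomputable def uF {n : ℕ} (Q : ℝ → Matrix (Fin n) (Fin n) ℝ) (lam t0 : ℝ)
    (S : Finset (Fin n → ℤ)) (c : (Fin n → ℤ) → ℂ) (p : SpaceTime n) : ℝ :=
  ∑ k ∈ S, Real.exp (-eF Q lam t0 k p.2) * csF (c k) ⟪xiV k, p.1⟫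

section
variable {n : ℕ} {Q : ℝ → Matrix (Fin n) (Fin n) ℝ} {lam t0 θ Θ : ℝ}

lemma continuous_Qc (hQ : ContinuousOn Q (Icc (-1) 0)) : Continuous fun t => Q (clp t) :=
  hQ.comp_continuous continuous_clp clp_mem

lemma continuous_qF (hQ : ContinuousOn Q (Icc (-1) 0)) (k : Fin n → ℤ) : Continuous (qF Q k) := by
  have := continuous_Qc hQ
  unfold qF
  exact (this.matrix_mul continuous_const).matrix_trace

lemma hasDerivAt_eF (hQ : ContinuousOn Q (Icc (-1) 0)) (k : Fin n → ℤ) (t : ℝ) :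
    HasDerivAt (eF Q lam t0 k) (lam⁻¹ * qF Q k t) t :=
  ((continuous_qF hQ k).integral_hasStrictDerivAt t0 t).hasDerivAt.const_mul _

lemma uF_test (hQ : ContinuousOn Q (Icc (-1) 0)) (hlam : lam ≠ 0) (S : Finset (Fin n → ℤ))
    (c : (Fin n → ℤ) → ℂ) (D : Set (SpaceTime n)) :
    ∃ φt g H, ParabolicTest (uF Q lam t0 S c) D φt g H ∧
      ∀ p, lam * φt p = (Q (clp p.2) * H p).trace := by
  have ht : ∀ k ∈ S, ParabolicTest (fun p : SpaceTime n => Real.exp (-eF Q lam t0 k p.2) * csF (c k) ⟪xiV k, p.1⟫) D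
      (fun p => -(lam⁻¹ * qF Q k p.2) * Real.exp (-eF Q lam t0 k p.2) * csF (c k) ⟪xiV k, p.1⟫)
      (fun p => Real.exp (-eF Q lam t0 k p.2) • csF (Complex.I * c k) ⟪xiV k, p.1⟫ • xiV k)
      (fun p => Real.exp (-eF Q lam t0 k p.2) • (-csF (c k) ⟪xiV k, p.1⟫) • tens (xiV k) (xiV k)) := by
    intro k _
    have h1 := (ParabolicTest.linear (D := D) (xiV k)).comp (hasDerivAt_csF (c k)) (hasDerivAt_csF (Complex.I * c k))
      (continuous_csF _)
    have hE : ∀ t, HasDerivAt (fun t => Real.exp (-eF Q lam t0 k t))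
        (-(lam⁻¹ * qF Q k t) * Real.exp (-eF Q lam t0 k t)) t := fun t => by
      refine ((hasDerivAt_eF hQ k t).neg.exp).congr_deriv ?_
      simp only [Pi.neg_apply]
      ring
    have hc : Continuous (fun t => -(lam⁻¹ * qF Q k t) * Real.exp (-eF Q lam t0 k t)) := by
      have e1 := continuous_qF hQ k
      have e2 : Continuous (eF Q lam t0 k) :=
        continuous_iff_continuousAt.2 fun t => (hasDerivAt_eF hQ k t).continuousAt
      fun_prop
    refine (ParabolicTest.timeMul (fun p _ => hE p.2) (fun p _ => hc.continuousAt) h1).congr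
      (fun _ => rfl) ?_ (fun _ => rfl) ?_
    · intro p; ring
    · intro p
      rw [smul_zero, zero_add, csF_I_I]
  refine ⟨_, _, _, ParabolicTest.sum S ht, ?_⟩
  intro p
  rw [Finset.mul_sum, Finset.mul_sum, Matrix.trace_sum]
  refine Finset.sum_congr rfl fun k _ => ?_
  rw [Matrix.mul_smul, Matrix.mul_smul, Matrix.trace_smul, Matrix.trace_smul, smul_eq_mul, smul_eq_mul]
  change _ = _ * (_ * qF Q k p.2)
  field_simp

lemma uF_init (S : Finset (Fin n → ℤ)) (c : (Fin n → ℤ) → ℂ) (x : Eucl n) :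
    uF Q lam t0 S c (x, t0) = ∑ k ∈ S, csF (c k) ⟪xiV k, x⟫ := by
  simp [uF, eF]

lemma continuous_entry (hQ : ContinuousOn Q (Icc (-1) 0)) (i j : Fin n) :
    Continuous fun t => Q (clp t) i j := (continuous_Qc hQ).matrix_elem i j

lemma uF_bound (hQ : ContinuousOn Q (Icc (-1) 0)) (hell : ∀ t ∈ Icc (-1 : ℝ) 0, Ell θ Θ (Q t))
    (hlam : 0 < lam) {S : Finset (Fin n → ℤ)} {c : (Fin n → ℤ) → ℂ} {a b : ℝ}
    (hb : ∀ x, (∑ k ∈ S, csF (c k) ⟪xiV k, x⟫) ∈ Icc a b) (x : Eucl n) {t : ℝ} (ht : t0 ≤ t) :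
    uF Q lam t0 S c (x, t) ∈ Icc a b := by
  set A : Matrix (Fin n) (Fin n) ℝ := fun i j => 2 * lam⁻¹ * ∫ s in t0..t, Q (clp s) i j with hA
  have hform : ∀ w : Eucl n, ∑ i, ∑ j, w i * A i j * w j =
      2 * lam⁻¹ * ∫ s in t0..t, (Q (clp s) * tens w w).trace := fun w => by
    simp only [trace_tens]
    have hc := fun i j => continuous_entry hQ i j
    have hc2 : ∀ i j, Continuous fun t => w i * Q (clp t) i j * w j := fun i j =>
      (continuous_const.mul (hc i j)).mul continuous_const
    rw [intervalIntegral.integral_finsetSum (fun i _ => (continuous_finsetSum _ fun j _ => hc2 i j).intervalIntegrable _ _), Finset.mul_sum]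
    refine Finset.sum_congr rfl fun i _ => ?_
    rw [intervalIntegral.integral_finsetSum (fun j _ => (hc2 i j).intervalIntegrable _ _), Finset.mul_sum]
    refine Finset.sum_congr rfl fun j _ => ?_
    rw [intervalIntegral.integral_mul_const, intervalIntegral.integral_const_mul, hA]
    ring
  have hpsd : A.PosSemidef := by
    refine Matrix.PosSemidef.of_dotProduct_mulVec_nonneg ?_ ?_
    · ext i j
      change star (A j i) = A i j
      rw [star_trivial]
      change 2 * lam⁻¹ * (∫ s in t0..t, Q (clp s) j i) = 2 * lam⁻¹ * (∫ s in t0..t, Q (clp s) i j)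
      refine congrArg _ ?_
      refine intervalIntegral.integral_congr fun s _ => ?_
      have := (hell _ (clp_mem s)).psd.isHermitian.apply i j
      simpa using this
    · intro w
      have h1 : star w ⬝ᵥ A.mulVec w = ∑ i, ∑ j, w i * A i j * w j := by
        simp [dotProduct, Matrix.mulVec, Finset.mul_sum, mul_assoc]
      rw [h1]
      have h2 := hform (WithLp.toLp 2 w)
      simp only at h2
      rw [h2]
      refine mul_nonneg (by positivity) (intervalIntegral.integral_nonneg ht fun s _ => ?_)
      rw [trace_tens]
      exact psd_form (hell _ (clp_mem s)).psd _
  have := gauss_bound hb hpsd x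
  convert this using 1
  refine Finset.sum_congr rfl fun k _ => ?_
  rw [trace_tens, hform]
  congr 2
  unfold eF qF
  ring

lemma qF_low (hell : ∀ t ∈ Icc (-1 : ℝ) 0, Ell θ Θ (Q t)) (k : Fin n → ℤ) (t : ℝ) :
    θ * ‖xiV k‖ ^ 2 ≤ qF Q k t := (hell _ (clp_mem t)).low _

lemma sabs_tens_le (w : Eucl n) : sabs (tens w w) ≤ n * ‖w‖ ^ 2 := by
  have h1 : sabs (tens w w) = (∑ i, |w i|) ^ 2 := by
    simp only [sabs, tens, abs_mul, sq, Finset.sum_mul_sum]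
  rw [h1, EuclideanSpace.real_norm_sq_eq]
  have := sq_sum_le_card_mul_sum_sq (s := Finset.univ) (f := fun i => |w i|)
  simpa using this

lemma qF_up (hell : ∀ t ∈ Icc (-1 : ℝ) 0, Ell θ Θ (Q t)) (hΘ : 0 ≤ Θ) (k : Fin n → ℤ) (t : ℝ) :
    |qF Q k t| ≤ Θ * n * ‖xiV k‖ ^ 2 := by
  refine ((hell _ (clp_mem t)).trace_le _).trans ?_
  rw [mul_assoc]
  exact mul_le_mul_of_nonneg_left (sabs_tens_le _) hΘ

lemma eF_low (hQ : ContinuousOn Q (Icc (-1) 0)) (hell : ∀ t ∈ Icc (-1 : ℝ) 0, Ell θ Θ (Q t))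
    (hlam : 0 < lam) (k : Fin n → ℤ) {t κ : ℝ} (hθ : 0 ≤ θ) (hκ : 0 ≤ κ) (ht : t0 + κ * lam ≤ t) :
    θ * κ * ‖xiV k‖ ^ 2 ≤ eF Q lam t0 k t := by
  have h0 : t0 ≤ t := by nlinarith
  have h1 : ∫ s in t0..t, (θ * ‖xiV k‖ ^ 2) ≤ ∫ s in t0..t, qF Q k s :=
    intervalIntegral.integral_mono_on h0 (by simp)
      ((continuous_qF hQ k).intervalIntegrable _ _) (fun s _ => qF_low hell k s)
  rw [intervalIntegral.integral_const, smul_eq_mul] at h1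
  have h2 : κ * lam * (θ * ‖xiV k‖ ^ 2) ≤ (t - t0) * (θ * ‖xiV k‖ ^ 2) := by
    gcongr; linarith
  rw [eF, le_inv_mul_iff₀ hlam]
  linarith

lemma eF_diff (hQ : ContinuousOn Q (Icc (-1) 0)) (hell : ∀ t ∈ Icc (-1 : ℝ) 0, Ell θ Θ (Q t))
    (hΘ : 0 ≤ Θ) (hlam : 0 < lam) (k : Fin n → ℤ) (t s : ℝ) :
    |eF Q lam t0 k t - eF Q lam t0 k s| ≤ Θ * n * ‖xiV k‖ ^ 2 * (|t - s| / lam) := by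
  have hi := fun a b => (continuous_qF hQ k).intervalIntegrable (μ := volume) a b
  rw [eF, eF, ← mul_sub, intervalIntegral.integral_interval_sub_left (hi _ _) (hi _ _), abs_mul,
    abs_of_pos (inv_pos.2 hlam)]
  have := intervalIntegral.norm_integral_le_of_norm_le_const (a := s) (b := t) (f := qF Q k)
    (C := Θ * n * ‖xiV k‖ ^ 2) (fun x _ => qF_up hell hΘ k x)
  rw [Real.norm_eq_abs] at this
  calc _ ≤ lam⁻¹ * (Θ * n * ‖xiV k‖ ^ 2 * |t - s|) := by gcongr
    _ = _ := by field_simp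

lemma exp_neg_diff {a b m : ℝ} (ha : m ≤ a) (hb : m ≤ b) :
    |Real.exp (-a) - Real.exp (-b)| ≤ Real.exp (-m) * |a - b| := by
  wlog h : a ≤ b generalizing a b
  · rw [abs_sub_comm, abs_sub_comm a]; exact this hb ha (le_of_not_ge h)
  rw [abs_of_nonneg (sub_nonneg.2 (Real.exp_le_exp.2 (by linarith))), abs_of_nonpos (by linarith)]
  have h1 : Real.exp (-b) = Real.exp (-a) * Real.exp (a - b) := by rw [← Real.exp_add]; ring_nf
  have h2 := Real.add_one_le_exp (a - b)
  have h3 : Real.exp (-a) ≤ Real.exp (-m) := Real.exp_le_exp.2 (by linarith)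
  have h4 := Real.exp_pos (-a)
  calc Real.exp (-a) - Real.exp (-b) = Real.exp (-a) * (1 - Real.exp (a - b)) := by rw [h1]; ring
    _ ≤ Real.exp (-a) * (-(a - b)) := by gcongr; linarith
    _ ≤ Real.exp (-m) * (-(a - b)) := by gcongr; linarith

lemma csF_diff (c : ℂ) (a b : ℝ) : |csF c a - csF c b| ≤ ‖c‖ * |a - b| := by
  have := Convex.norm_image_sub_le_of_norm_hasDerivWithin_le (f := csF c) (f' := csF (Complex.I * c)) (C := ‖c‖)
    (s := univ) (x := b) (y := a) (fun x _ => (hasDerivAt_csF c x).hasDerivWithinAt)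
    (fun x _ => by
      rw [Real.norm_eq_abs]
      refine (abs_csF_le _ _).trans ?_
      simp) convex_univ trivial trivial
  simpa using this

/-- weight -/
noncomputable def wF {n : ℕ} (κ : ℝ) (k : Fin n → ℤ) : ℝ :=
  Real.exp (-(κ * ‖xiV k‖ ^ 2)) * (1 + ‖xiV k‖ ^ 2)

lemma uF_diff (hQ : ContinuousOn Q (Icc (-1) 0)) (hell : ∀ t ∈ Icc (-1 : ℝ) 0, Ell θ Θ (Q t))
    (hΘ : 0 ≤ Θ) (hθ : 0 ≤ θ) (hlam : 0 < lam) {S : Finset (Fin n → ℤ)} {c : (Fin n → ℤ) → ℂ}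
    (hc : ∀ k ∈ S, ‖c k‖ ≤ 2) {κ t s : ℝ} (hκ : 0 ≤ κ) (ht : t0 + κ * lam ≤ t) (hs : t0 + κ * lam ≤ s) (x y : Eucl n) :
    |uF Q lam t0 S c (x, t) - uF Q lam t0 S c (y, s)| ≤
      2 * (∑ k ∈ S, wF (θ * κ) k) * (Θ * n * (|t - s| / lam) + ‖x - y‖) := by
  have hd : 0 ≤ |t - s| / lam := by positivity
  rw [uF, uF, ← Finset.sum_sub_distrib, Finset.mul_sum, Finset.sum_mul]
  refine (Finset.abs_sum_le_sum_abs _ _).trans (Finset.sum_le_sum fun k hk => ?_)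
  have hck := hc k hk
  set e := Real.exp (-(θ * κ * ‖xiV k‖ ^ 2)) with he
  have e1 := exp_neg_diff (eF_low hQ hell hlam k hθ hκ ht) (eF_low hQ hell hlam k hθ hκ hs)
  have e2 := eF_diff (t0 := t0) hQ hell hΘ hlam k t s
  have e3 := abs_csF_le (c k) ⟪xiV k, x⟫
  have e4 := csF_diff (c k) ⟪xiV k, x⟫ ⟪xiV k, y⟫
  have e5 : |⟪xiV k, x⟫ - ⟪xiV k, y⟫| ≤ ‖xiV k‖ * ‖x - y‖ := by
    rw [← inner_sub_right]; exact abs_real_inner_le_norm _ _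
  have e6 : Real.exp (-eF Q lam t0 k s) ≤ e := Real.exp_le_exp.2 (by
    linarith [eF_low (t0 := t0) hQ hell hlam k hθ hκ hs])
  have e7 : ‖xiV k‖ ≤ 1 + ‖xiV k‖ ^ 2 := by nlinarith [sq_nonneg (‖xiV k‖ - 1)]
  have hep : 0 < e := Real.exp_pos _
  simp only
  rw [show Real.exp (-eF Q lam t0 k t) * csF (c k) ⟪xiV k, x⟫ - Real.exp (-eF Q lam t0 k s) * csF (c k) ⟪xiV k, y⟫
    = (Real.exp (-eF Q lam t0 k t) - Real.exp (-eF Q lam t0 k s)) * csF (c k) ⟪xiV k, x⟫ +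
      Real.exp (-eF Q lam t0 k s) * (csF (c k) ⟪xiV k, x⟫ - csF (c k) ⟪xiV k, y⟫) by ring]
  refine (abs_add_le _ _).trans ?_
  rw [abs_mul, abs_mul, abs_of_pos (Real.exp_pos (-eF Q lam t0 k s))]
  calc _ ≤ (e * (Θ * n * ‖xiV k‖ ^ 2 * (|t - s| / lam))) * 2 + e * (2 * (‖xiV k‖ * ‖x - y‖)) := by
        gcongr
        · exact e1.trans (by gcongr)
        · exact e3.trans hck
        · exact e4.trans (by gcongr)
    _ ≤ (e * (Θ * n * (1 + ‖xiV k‖ ^ 2) * (|t - s| / lam))) * 2 + e * (2 * ((1 + ‖xiV k‖ ^ 2) * ‖x - y‖)) := by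
        gcongr; linarith
    _ = _ := by rw [wF, ← he]; ring
end


lemma summable_gauss_int {a : ℝ} (ha : 0 < a) : Summable fun m : ℤ => Real.exp (-(a * (m : ℝ) ^ 2)) := by
  have h1 : Summable fun m : ℤ => a⁻¹ * (1 / (m : ℝ) ^ 2) :=
    ((Real.summable_one_div_int_pow (p := 2)).2 (by norm_num)).mul_left _
  refine Summable.of_norm_bounded_eventually h1 ?_
  filter_upwards [(Set.finite_singleton (0 : ℤ)).compl_mem_cofinite] with m hm
  have hm0 : (m : ℝ) ≠ 0 := by exact_mod_cast hm
  rw [Real.norm_eq_abs, abs_of_pos (Real.exp_pos _)]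
  refine (exp_neg_le_inv (by positivity)).trans (le_of_eq ?_)
  field_simp

lemma sum_wF_le (n : ℕ) {κ : ℝ} (hκ : 0 < κ) :
    ∃ L > 0, ∀ S : Finset (Fin n → ℤ), ∑ k ∈ S, wF κ k ≤ L := by
  classical
  set a : ℝ := κ / 2 * (2 * Real.pi) ^ 2 with ha
  have hap : 0 < a := by rw [ha]; positivity
  set h : ℤ → ℝ := fun m => Real.exp (-(a * (m : ℝ) ^ 2)) with hh
  have hs : Summable h := summable_gauss_int hap
  have hpt : ∀ k : Fin n → ℤ, wF κ k ≤ (1 + 2 / κ) * ∏ i, h (k i) := fun k => by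
    have e1 : ∏ i, h (k i) = Real.exp (-(κ / 2 * ‖xiV k‖ ^ 2)) := by
      rw [hh, ← Real.exp_sum, EuclideanSpace.real_norm_sq_eq, Finset.mul_sum, ← Finset.sum_neg_distrib]
      congr 1
      refine Finset.sum_congr rfl fun i _ => ?_
      simp only [xiV, ha]; ring
    rw [e1, wF]
    set z := ‖xiV k‖ ^ 2 with hz
    have hz0 : 0 ≤ z := by positivity
    have e2 : Real.exp (-(κ * z)) = Real.exp (-(κ / 2 * z)) * Real.exp (-(κ / 2 * z)) := by
      rw [← Real.exp_add]; ring_nf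
    have e3 : Real.exp (-(κ / 2 * z)) * (1 + z) ≤ 1 + 2 / κ := by
      have f1 : Real.exp (-(κ / 2 * z)) ≤ 1 := Real.exp_le_one_iff.2 (by have : 0 ≤ κ / 2 * z := by positivity
                                                                         linarith)
      have f2 : Real.exp (-(κ / 2 * z)) * z ≤ 2 / κ := by
        rcases hz0.eq_or_lt with h0 | h0
        · rw [← h0]; simp; positivity
        · have := exp_neg_le_inv (x := κ / 2 * z) (by positivity)
          calc _ ≤ 1 / (κ / 2 * z) * z := by gcongr
            _ = _ := by field_simp
      linarith
    rw [e2]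
    calc _ = Real.exp (-(κ / 2 * z)) * (Real.exp (-(κ / 2 * z)) * (1 + z)) := by ring
      _ ≤ Real.exp (-(κ / 2 * z)) * (1 + 2 / κ) := by gcongr
      _ = _ := by ring
  have hpos : ∀ m, 0 ≤ h m := fun m => (Real.exp_pos _).le
  have ht : 0 ≤ ∑' m, h m := tsum_nonneg hpos
  refine ⟨(1 + 2 / κ) * (∑' m, h m) ^ n + 1, by positivity, fun S => ?_⟩
  have h1 : ∑ k ∈ S, ∏ i, h (k i) ≤ (∑' m, h m) ^ n := by
    calc ∑ k ∈ S, ∏ i, h (k i) ≤ ∑ k ∈ Fintype.piFinset (fun i => S.image (fun k => k i)), ∏ i, h (k i) := by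
          refine Finset.sum_le_sum_of_subset_of_nonneg ?_ (fun k _ _ => Finset.prod_nonneg fun i _ => hpos _)
          intro k hk
          rw [Fintype.mem_piFinset]
          exact fun i => Finset.mem_image_of_mem _ hk
      _ = ∏ i : Fin n, ∑ m ∈ S.image (fun k => k i), h m := (Finset.prod_univ_sum _ _).symm
      _ ≤ ∏ i : Fin n, ∑' m, h m := Finset.prod_le_prod (fun i _ => Finset.sum_nonneg fun m _ => hpos m)
          (fun i _ => hs.sum_le_tsum _ (fun m _ => hpos m))
      _ = _ := by simp
  calc _ ≤ ∑ k ∈ S, (1 + 2 / κ) * ∏ i, h (k i) := Finset.sum_le_sum fun k _ => hpt k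
    _ = (1 + 2 / κ) * ∑ k ∈ S, ∏ i, h (k i) := by rw [Finset.mul_sum]
    _ ≤ (1 + 2 / κ) * (∑' m, h m) ^ n := by gcongr
    _ ≤ _ := by linarith

lemma sq_test {n : ℕ} (x0 : Eucl n) (D : Set (SpaceTime n)) :
    ParabolicTest (fun p : SpaceTime n => ‖p.1 - x0‖ ^ 2) D (fun _ => 0) (fun p => (2 : ℝ) • (p.1 - x0))
      (fun _ => (2 : ℝ) • (1 : Matrix (Fin n) (Fin n) ℝ)) := by
  refine ParabolicTest.space (f := fun x => ‖x - x0‖ ^ 2) (g := fun x => (2 : ℝ) • (x - x0))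
    (H := fun _ => (2 : ℝ) • 1) ?_ ?_ continuous_const ?_
  · intro x
    rw [hasGradientAt_iff_hasFDerivAt]
    refine (((hasStrictFDerivAt_norm_sq (x - x0)).hasFDerivAt).comp x
      ((hasFDerivAt_id x).sub_const x0)).congr_fderiv ?_
    ext w
    simp
  · intro x
    refine (((hasFDerivAt_id x).sub_const x0).const_smul (2 : ℝ)).congr_fderiv ?_
    ext w i
    rw [mclm_smul, _root_.smul_apply, _root_.smul_apply]
    simp
  · intro x; simp [Matrix.IsSymm]

/-- one sided comparison with a smooth solution -/
lemma cmp_solution {d : ℕ} {lam θ Θ M : ℝ} {Q : ℝ → Matrix (Fin (d + 1)) (Fin (d + 1)) ℝ} {v : ℝ → Eucl (d + 1)}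
    (hD : Dat d lam θ Θ M Q v) (hΘ : 0 ≤ Θ) {η : SpaceTime (d + 1) → ℝ} (hη : ObliqueSup d lam Q v η)
    (h0 : ∀ p ∈ KcP d 1, 0 ≤ η p) {ta tb ε : ℝ} (hta : -1 < ta) (htb : tb ≤ 0) (hε : 0 < ε)
    {u φt : SpaceTime (d + 1) → ℝ} {g : SpaceTime (d + 1) → Eucl (d + 1)}
    {H : SpaceTime (d + 1) → Matrix (Fin (d + 1)) (Fin (d + 1)) ℝ} (hu : ParabolicTest u univ φt g H)
    (heq : ∀ p : SpaceTime (d + 1), p.2 ∈ Icc (-1 : ℝ) 0 → lam * φt p = (Q p.2 * H p).trace)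
    (hup : ∀ p : SpaceTime (d + 1), ta ≤ p.2 → u p ≤ 1 + ε)
    (hin : ∀ x ∈ closedBall ((1 / 2 : ℝ) • eV d) (1/4), u (x, ta) - ε ≤ η (x, ta))
    (x : Eucl (d + 1)) (t : ℝ) (ht : t ∈ Icc ta tb) (hx : ‖x - (1 / 2 : ℝ) • eV d‖ ≤ 1 / 4) :
    u (x, t) - ε - 16 * ‖x - (1 / 2 : ℝ) • eV d‖ ^ 2
      - 16 * (2 * Θ * (d + 1) + 1) * ((t - ta) / lam) ≤ η (x, t) := by
  have hlam := hD.lam_pos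
  set x0 := (1 / 2 : ℝ) • eV d with hx0
  have hnx0 : ‖x0‖ = 1 / 2 := by rw [hx0, norm_smul, norm_eV]; norm_num
  have hlx0 : lastC x0 = 1 / 2 := by rw [hx0, lastC_smul, lastC_eV]; norm_num
  have hlast : ∀ y : Eucl (d + 1), ‖y - x0‖ ≤ 1 / 4 → 1 / 4 ≤ lastC y := fun y hy => by
    have h1 := abs_lastC_le (y - x0)
    rw [lastC_sub, hlx0] at h1
    have h2 : (lastC y - 1 / 2) ^ 2 ≤ (1 / 4) ^ 2 := h1.trans (by gcongr)
    have := abs_le.1 (abs_le_of_sq_le_sq h2 (by norm_num))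
    linarith [this.1, this.2]
  set K : ℝ := 2 * Θ * (d + 1) + 1 with hK
  have hK0 : 0 < K := by rw [hK]; positivity
  set φ : SpaceTime (d + 1) → ℝ := fun p => u p + (-ε) + (-16) * ‖p.1 - x0‖ ^ 2 + (-(16 * K / lam)) * (p.2 - ta) with hφ
  have hT : ParabolicTest φ univ (fun p => φt p + (-16) * 0 + (-(16 * K / lam)) * 1)
      (fun p => g p + (-16 : ℝ) • ((2 : ℝ) • (p.1 - x0)) + (-(16 * K / lam)) • (0 : Eucl (d + 1)))
      (fun p => H p + (-16 : ℝ) • ((2 : ℝ) • (1 : Matrix (Fin (d + 1)) (Fin (d + 1)) ℝ)) +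
        (-(16 * K / lam)) • (0 : Matrix (Fin (d + 1)) (Fin (d + 1)) ℝ)) :=
    ((hu.addc (-ε)).add ((sq_test x0 univ).cmul (-16))).add
      ((ParabolicTest.time (a := fun t => t - ta) (a' := fun _ => 1)
        (fun p _ => (hasDerivAt_id p.2).sub_const ta) (fun p _ => continuousAt_const)).cmul (-(16 * K / lam)))
  have hsub : Om d x0 (1 / 4) ta tb ⊆ KcP d 1 := Om_sub (by rw [hnx0]; norm_num) hta htb
  have hmain : ∀ p ∈ Om d x0 (1 / 4) ta tb, φ p ≤ η p := by
    refine compare hη (by rw [hnx0]; norm_num) hta htb (hT.contPhi.mono (subset_univ _)) ?_ ?_ ?_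
    · rintro ⟨y, s⟩ hp hs
      simp only at hs
      subst hs
      have := hin y (by rw [mem_closedBall, dist_eq_norm]; exact hp.1)
      have h2 : 0 ≤ ‖y - x0‖ ^ 2 := by positivity
      simp only [hφ, sub_self, mul_zero]
      linarith
    · intro p hp hl
      refine le_trans ?_ (h0 p (hsub hp))
      have h1 := hup p hp.2.2.1
      have h2 : 0 ≤ 16 * K / lam * (p.2 - ta) := mul_nonneg (by positivity) (by linarith [hp.2.2.1])
      simp only [hφ, hl]
      linarith
    · intro p hp hpt hpl _
      have hlp := hlast p.1 hp.1
      have hpI : p.2 ∈ Icc (-1 : ℝ) 0 := ⟨by linarith, hp.2.2.2.trans htb⟩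
      refine ⟨φ, _, _, _, hT.mono (subset_univ _), fun _ _ _ => le_rfl, rfl, ?_, ?_⟩
      · intro _
        have hQt : (Q p.2).trace ≤ (d + 1) * Θ := by
          have h3 : ∀ i ∈ (Finset.univ : Finset (Fin (d + 1))), (Q p.2) i i ≤ Θ := fun i _ =>
            (le_abs_self _).trans ((hD.ell _ hpI).ent i i)
          have := Finset.sum_le_card_nsmul _ _ _ h3
          simpa [Matrix.trace, nsmul_eq_mul] using this
        have e1 : (Q p.2 * (H p + (-16 : ℝ) • ((2 : ℝ) • (1 : Matrix (Fin (d + 1)) (Fin (d + 1)) ℝ)) +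
            (-(16 * K / lam)) • (0 : Matrix (Fin (d + 1)) (Fin (d + 1)) ℝ))).trace
            = lam * φt p - 32 * (Q p.2).trace := by
          rw [heq p hpI, smul_zero, add_zero, smul_smul, Matrix.mul_add, Matrix.trace_add, Matrix.mul_smul, Matrix.trace_smul,
            mul_one, smul_eq_mul]
          ring
        rw [e1]
        have e2 : lam * (φt p + (-16) * 0 + (-(16 * K / lam)) * 1) = lam * φt p - 16 * K := by
          field_simp; ring
        rw [e2, hK]
        linarith
      · intro h; linarith
  have hfin := hmain (x, t) ⟨hx, by have := hlast x hx; show 0 ≤ lastC x; linarith, ht⟩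
  have : φ (x, t) = u (x, t) - ε - 16 * ‖x - x0‖ ^ 2 - 16 * K * ((t - ta) / lam) := by
    simp only [hφ]; ring
  rw [this] at hfin
  exact hfin


lemma interior_dichotomy (d : ℕ) {θ Θ M : ℝ} (hθ : 0 < θ) (hΘ : 0 < Θ) :
    ∃ r T : ℝ, 0 < r ∧ r ≤ 1 / 32 ∧ 0 < T ∧ T ≤ 1 / 16 ∧
    ∀ (lam : ℝ) (Q : ℝ → Matrix (Fin (d + 1)) (Fin (d + 1)) ℝ) (v : ℝ → Eucl (d + 1))
      (η : SpaceTime (d + 1) → ℝ), Dat d lam θ Θ M Q v → ContinuousOn Q (Icc (-1) 0) →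
      ObliqueSup d lam Q v η → ObliqueSup d lam Q v (fun p => 1 - η p) →
      (∀ p ∈ KcP d 1, 0 ≤ η p ∧ η p ≤ 1) → ∀ t : ℝ, -(3 / 4) ≤ t → t + T * lam ≤ 0 →
      (∀ x, ‖x - (1 / 2 : ℝ) • eV d‖ ≤ r → ∀ s ∈ Icc t (t + T * lam), 1 / 4 ≤ η (x, s)) ∨
      (∀ x, ‖x - (1 / 2 : ℝ) • eV d‖ ≤ r → ∀ s ∈ Icc t (t + T * lam), 1 / 4 ≤ 1 - η (x, s)) := by
  set K : ℝ := 2 * Θ * (d + 1) + 1 with hK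
  have hK0 : 0 < K := by rw [hK]; positivity
  set T1 : ℝ := min (1 / 8) (1 / (512 * K)) with hT1
  have hT1p : 0 < T1 := by rw [hT1]; positivity
  have hT18 : T1 ≤ 1 / 8 := min_le_left _ _
  have hT1K : 16 * K * T1 ≤ 1 / 32 := by
    have : T1 ≤ 1 / (512 * K) := min_le_right _ _
    rw [le_div_iff₀ (by positivity)] at this
    linarith
  clear_value T1
  obtain ⟨L, hL, hsum⟩ := sum_wF_le (d + 1) (κ := θ * (T1 / 2)) (by positivity)
  set N : ℝ := ((d + 1 : ℕ) : ℝ) with hN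
  have hN0 : 0 ≤ N := by rw [hN]; positivity
  set T : ℝ := min (T1 / 2) (1 / (16 * L * (Θ * N + 1))) with hT
  set r : ℝ := min (1 / 32) (1 / (32 * L)) with hr
  have hTp : 0 < T := by rw [hT]; positivity
  have hrp : 0 < r := by rw [hr]; positivity
  have hTT : T ≤ T1 / 2 := min_le_left _ _
  have hr32 : r ≤ 1 / 32 := min_le_left _ _
  have hTL : 2 * L * (Θ * N * T) ≤ 1 / 8 := by
    have : T ≤ 1 / (16 * L * (Θ * N + 1)) := min_le_right _ _
    rw [le_div_iff₀ (by positivity)] at this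
    have h2 : 0 ≤ T * L := by positivity
    linarith
  have hrL : 2 * L * (2 * r) ≤ 1 / 8 := by
    have : r ≤ 1 / (32 * L) := min_le_right _ _
    rw [le_div_iff₀ (by positivity)] at this
    linarith
  clear_value T r
  refine ⟨r, T, hrp, hr32, hTp, by linarith, ?_⟩
  intro lam Q v η hD hQ hs1 hs2 h01 t ht htT
  have hlam := hD.lam_pos
  have hlam1 := hD.lam_le
  set x0 := (1 / 2 : ℝ) • eV d with hx0
  have hnx0 : ‖x0‖ = 1 / 2 := by rw [hx0, norm_smul, norm_eV]; norm_num
  have hlx0 : lastC x0 = 1 / 2 := by rw [hx0, lastC_smul, lastC_eV]; norm_num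
  set t0 : ℝ := t - T1 / 2 * lam with ht0
  have hTl : T1 / 2 * lam ≤ 1 / 16 := by nlinarith
  have ht0' : -1 < t0 := by rw [ht0]; linarith
  have ht0t : t0 + T1 / 2 * lam = t := by rw [ht0]; ring
  have hTlp : 0 < T1 / 2 * lam := by positivity
  have hTlp2 : 0 < T * lam := by positivity
  have hball : ∀ y ∈ closedBall x0 (1 / 4), (y, t0) ∈ KcP d 1 := by
    intro y hy
    rw [mem_closedBall, dist_eq_norm] at hy
    refine Om_sub (c := x0) (r := 1 / 4) (ta := t0) (tb := 0) (by rw [hnx0]; norm_num) ht0' le_rfl ⟨hy, ?_, le_rfl, by linarith⟩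
    have h1 := abs_lastC_le (y - x0)
    rw [lastC_sub, hlx0] at h1
    have h2 : (lastC y - 1 / 2) ^ 2 ≤ (1 / 4) ^ 2 := h1.trans (by gcongr)
    have := abs_le.1 (abs_le_of_sq_le_sq h2 (by norm_num))
    show 0 ≤ lastC y
    linarith [this.1, this.2]
  have hfc : ContinuousOn (fun x => η (x, t0)) (closedBall x0 (1 / 4)) :=
    hs1.1.comp (by fun_prop) hball
  obtain ⟨S, c, hc, hb, hap⟩ := trig_approx x0 hfc (fun x hx => h01 _ (hball x hx)) (ε := 1 / 32) (by norm_num)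
  set u := uF Q lam t0 S c with hu
  obtain ⟨φt, g, H, hut, hueq⟩ := uF_test (t0 := t0) hQ hlam.ne' S c univ
  have hub : ∀ p : SpaceTime (d + 1), t0 ≤ p.2 → u p ∈ Icc (-(1 / 32 : ℝ)) (1 + 1 / 32) := fun p hp =>
    uF_bound hQ hD.ell hlam hb p.1 hp
  have hsmall : ∀ x, ‖x - x0‖ ≤ r → 16 * ‖x - x0‖ ^ 2 ≤ 1 / 64 := fun x hx => by
    have : ‖x - x0‖ ^ 2 ≤ (1 / 32) ^ 2 := by gcongr; linarith
    linarith
  have htime : ∀ s ∈ Icc t (t + T * lam), 16 * K * ((s - t0) / lam) ≤ 1 / 32 := fun s hs => by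
    have h1 : (s - t0) / lam ≤ T1 := by
      rw [div_le_iff₀ hlam]
      have : T * lam ≤ T1 / 2 * lam := by gcongr
      linarith [hs.2]
    calc _ ≤ 16 * K * T1 := by gcongr
      _ ≤ _ := hT1K
  have c1 : ∀ x, ‖x - x0‖ ≤ r → ∀ s ∈ Icc t (t + T * lam), u (x, s) - 3 / 32 ≤ η (x, s) := by
    intro x hx s hs
    have := cmp_solution hD hΘ.le hs1 (fun p hp => (h01 p hp).1) ht0' htT (ε := 1 / 32) (by norm_num) hut
      (fun p hp => by rw [hueq, clp_eq hp]) (fun p hp => (hub p hp).2)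
      (fun x hx => by
        have := abs_le.1 (hap x hx)
        rw [uF_init]; linarith) x s ⟨by linarith [hs.1], hs.2⟩ (by rw [← hx0]; linarith)
    have e1 := hsmall x hx
    have e2 := htime s hs
    linarith
  have c2 : ∀ x, ‖x - x0‖ ≤ r → ∀ s ∈ Icc t (t + T * lam), η (x, s) ≤ u (x, s) + 3 / 32 := by
    intro x hx s hs
    have := cmp_solution hD hΘ.le hs2 (fun p hp => by linarith [(h01 p hp).2]) ht0' htT (ε := 1 / 32) (by norm_num)
      ((hut.cmul (-1)).addc 1)
      (fun p hp => by
        rw [Matrix.mul_smul, Matrix.trace_smul, smul_eq_mul]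
        have := hueq p
        rw [clp_eq hp] at this
        linarith) (fun p hp => by
          have := (hub p hp).1
          linarith)
      (fun x hx => by
        have := abs_le.1 (hap x hx)
        rw [uF_init]; linarith) x s ⟨by linarith [hs.1], hs.2⟩ (by rw [← hx0]; linarith)
    have e1 := hsmall x hx
    have e2 := htime s hs
    linarith
  have hosc : ∀ x, ‖x - x0‖ ≤ r → ∀ s ∈ Icc t (t + T * lam), ∀ y, ‖y - x0‖ ≤ r → ∀ s' ∈ Icc t (t + T * lam),
      |u (x, s) - u (y, s')| ≤ 1 / 4 := by
    intro x hx s hs y hy s' hs'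
    refine (uF_diff hQ hD.ell hΘ.le hθ.le hlam (fun k hk => (hc k hk).trans (by norm_num)) (κ := T1 / 2)
      (by positivity) (by linarith [hs.1]) (by linarith [hs'.1]) x y).trans ?_
    have h1 : |s - s'| / lam ≤ T := by
      rw [div_le_iff₀ hlam, abs_le]
      constructor <;> linarith [hs.1, hs.2, hs'.1, hs'.2]
    have h2 : ‖x - y‖ ≤ 2 * r := by
      have : x - y = (x - x0) - (y - x0) := by abel
      rw [this]; exact (norm_sub_le _ _).trans (by linarith)
    have h3 := hsum S
    calc _ ≤ 2 * L * (Θ * N * T + 2 * r) := by gcongr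
      _ ≤ _ := by linarith
  by_cases hcase : ∀ x, ‖x - x0‖ ≤ r → ∀ s ∈ Icc t (t + T * lam), 1 / 4 ≤ η (x, s)
  · exact Or.inl hcase
  · push Not at hcase
    obtain ⟨x, hx, s, hs, hlt⟩ := hcase
    refine Or.inr fun y hy s' hs' => ?_
    have := abs_le.1 (hosc x hx s hs y hy s' hs')
    linarith [c1 x hx s hs, c2 y hy s' hs']


lemma accumulate {d : ℕ} {lam θ Θ M C c1 r T δ δ' : ℝ}
    {Q : ℝ → Matrix (Fin (d + 1)) (Fin (d + 1)) ℝ}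
    {v : ℝ → Eucl (d + 1)} {g : Eucl (d + 1) → ℝ} {G : Eucl (d + 1) → Eucl (d + 1)}
    {H : Eucl (d + 1) → Matrix (Fin (d + 1)) (Fin (d + 1)) ℝ}
    (hD : Dat d lam θ Θ M Q v) (hg : BarG d θ Θ M C c1 g G H)
    {η : SpaceTime (d + 1) → ℝ} (hη : ObliqueSup d lam Q v η) (hpos : ∀ p ∈ KcP d 1, 0 ≤ η p)
    (hT : 0 < T) (hδ' : 0 < δ') (hδ : δ' ≤ δ) (hδT : δ' * Real.exp C ≤ T / 2)
    (hstep : ∀ b tk : ℝ, 0 ≤ b → b * Real.exp C ≤ 1 / 8 → -1 < tk →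
      tk + T * lam ≤ 0 →
      (∀ x, ‖x - (1 / 2 : ℝ) • eV d‖ ≤ r → ∀ t ∈ Icc tk (tk + T * lam), 1 / 4 ≤ η (x, t)) →
      (∀ x ∈ HB d, b * Real.exp (-C * tk) * max (g x) 0 ≤ η (x, tk)) →
      ∀ x ∈ HB d, (b + δ * lam) * Real.exp (-C * (tk + T * lam)) * max (g x) 0
        ≤ η (x, tk + T * lam))
    {N : ℕ} (hN : N * (T * lam) ≤ 1 / 4) (P : ℕ → Prop) [DecidablePred P]
    (hP : ∀ k < N, P k → ∀ x, ‖x - (1 / 2 : ℝ) • eV d‖ ≤ r →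
      ∀ t ∈ Icc (-(3 / 4) + k * (T * lam)) (-(3 / 4) + k * (T * lam) + T * lam), 1 / 4 ≤ η (x, t)) :
    ∀ p ∈ KcP d (1 / 2), (Nat.count P N : ℝ) * (δ' * lam) * c1 ≤ η p := by
  have hl := hD.lam_pos
  have hTl : 0 < T * lam := by positivity
  have main : ∀ k : ℕ, k ≤ N → ∀ x ∈ HB d,
      ((Nat.count P k : ℝ) * (δ' * lam)) * Real.exp (-C * (-(3 / 4) + k * (T * lam))) * max (g x) 0
        ≤ η (x, -(3 / 4) + k * (T * lam)) := by
    intro k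
    induction k with
    | zero =>
      intro _ x hx
      simp only [Nat.count_zero, Nat.cast_zero, zero_mul]
      exact hpos _ (HB_KcP hx (by norm_num) (by norm_num))
    | succ k ih =>
      intro hk x hx
      have ih' := ih (by omega)
      have hkN : ((k : ℝ) + 1) ≤ N := by exact_mod_cast hk
      have hk0 : (0 : ℝ) ≤ k := Nat.cast_nonneg k
      have e : -(3 / 4) + ((k + 1 : ℕ) : ℝ) * (T * lam) = -(3 / 4) + k * (T * lam) + T * lam := by
        push_cast; ring
      have hend : -(3 / 4) + k * (T * lam) + T * lam ≤ 0 := by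
        have := mul_le_mul_of_nonneg_right hkN hTl.le
        linarith
      have hst : -1 < -(3 / 4) + k * (T * lam) := by
        have := mul_nonneg hk0 hTl.le
        linarith
      have hb0 : 0 ≤ (Nat.count P k : ℝ) * (δ' * lam) := by positivity
      rw [e]
      by_cases hPk : P k
      · have hc : (Nat.count P k : ℝ) ≤ N := by
          exact_mod_cast (Nat.count_le (p := P) (n := k)).trans (by omega)
        have hb8 : (Nat.count P k : ℝ) * (δ' * lam) * Real.exp C ≤ 1 / 8 := by
          calc (Nat.count P k : ℝ) * (δ' * lam) * Real.exp C
              = (Nat.count P k : ℝ) * lam * (δ' * Real.exp C) := by ring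
            _ ≤ N * lam * (T / 2) := by gcongr
            _ ≤ 1 / 8 := by linarith
        have := hstep _ _ hb0 hb8 hst hend (hP k (by omega) hPk) ih' x hx
        refine le_trans ?_ this
        rw [Nat.count_succ, if_pos hPk]
        push_cast
        have : ((Nat.count P k : ℝ) + 1) * (δ' * lam) ≤ Nat.count P k * (δ' * lam) + δ * lam := by
          have := mul_le_mul_of_nonneg_right hδ hl.le
          linarith
        gcongr
      · rw [Nat.count_succ, if_neg hPk, add_zero]
        exact propagate hD hg hη hpos hb0 hst hend ih' x hx _ ⟨by linarith, le_rfl⟩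
  intro p hp
  have hN0 : (0 : ℝ) ≤ N * (T * lam) := by positivity
  have hx : p.1 ∈ HB d ∧ ‖p.1‖ < 1 / 2 ∧ -(1 / 2) < p.2 ∧ p.2 ≤ 0 := by
    have aux : ‖p.1‖ < 1 / 2 → ‖p.1‖ ^ 2 ≤ 3 / 4 := fun h => by
      nlinarith [norm_nonneg p.1]
    rcases hp with ⟨h1, h2, h3⟩ | ⟨h1, h2, h3⟩
    · have h1 : ‖p.1‖ < 1 / 2 := by simpa using h1
      exact ⟨⟨h2.le, aux h1⟩, h1, h3.1, h3.2⟩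
    · have h1 : ‖p.1‖ < 1 / 2 := by simpa using h1
      exact ⟨⟨h2.ge, aux h1⟩, h1, h3.1, h3.2⟩
  obtain ⟨hx, hx2, ht1, ht2⟩ := hx
  have hb0 : 0 ≤ (Nat.count P N : ℝ) * (δ' * lam) := by positivity
  have := propagate hD hg hη hpos hb0 (ta := -(3 / 4) + N * (T * lam)) (tb := 0)
    (by linarith) le_rfl (main N le_rfl) p.1 hx p.2 ⟨by linarith, ht2⟩
  refine le_trans ?_ this
  have he : 1 ≤ Real.exp (-C * p.2) := Real.one_le_exp (by nlinarith [hg.Cpos])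
  have hm : c1 ≤ max (g p.1) 0 := (hg.half _ hx hx2).trans (le_max_left _ _)
  have := hg.c1pos
  calc (Nat.count P N : ℝ) * (δ' * lam) * c1 = (Nat.count P N : ℝ) * (δ' * lam) * 1 * c1 := by ring
    _ ≤ _ := by gcongr

lemma exists_mu (d : ℕ) {θ Θ M : ℝ} (hθ : 0 < θ) (hΘ : 0 < Θ) (hM : 1 ≤ M) :
    ∃ μ : ℝ, 0 < μ ∧ μ < 1 ∧
    ∀ (lam : ℝ) (Q : ℝ → Matrix (Fin (d + 1)) (Fin (d + 1)) ℝ) (v : ℝ → Eucl (d + 1))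
      (η : SpaceTime (d + 1) → ℝ), Dat d lam θ Θ M Q v → ContinuousOn Q (Icc (-1) 0) →
      ObliqueSup d lam Q v η → ObliqueSup d lam Q v (fun p => 1 - η p) →
      (∀ p ∈ KcP d 1, 0 ≤ η p ∧ η p ≤ 1) →
      (∀ p ∈ KcP d (1 / 2), μ ≤ η p) ∨ (∀ p ∈ KcP d (1 / 2), μ ≤ 1 - η p) := by
  obtain ⟨r, T, hr, -, hT, hT16, hdich⟩ := interior_dichotomy d (M := M) hθ hΘ
  obtain ⟨C, c1, g, G, H, hg⟩ := exists_barG d hθ hΘ hM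
  obtain ⟨c2, S, f, Gf, Hf, hf⟩ := exists_barF d hr
  obtain ⟨δ, hδ, hstep⟩ := good_step d hθ hΘ hM hr hT (by linarith) hg hf
  have hc1 := hg.c1pos
  set δ' : ℝ := min δ (T * Real.exp (-C) / 2) with hδ'
  have hδ'0 : 0 < δ' := by rw [hδ']; positivity
  have hδ'T : δ' * Real.exp C ≤ T / 2 := by
    calc δ' * Real.exp C ≤ (T * Real.exp (-C) / 2) * Real.exp C := by
          gcongr; exact min_le_right _ _
      _ = T / 2 * (Real.exp (-C) * Real.exp C) := by ring
      _ = T / 2 := by rw [← Real.exp_add]; simp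
  refine ⟨min (1 / 2) (δ' * c1 / (16 * T)), by positivity,
    lt_of_le_of_lt (min_le_left _ _) (by norm_num), ?_⟩
  intro lam Q v η hD hQ hη hη' h01
  classical
  have hl := hD.lam_pos
  have hl1 := hD.lam_le
  have hTl : 0 < T * lam := by positivity
  have hTl16 : T * lam ≤ 1 / 16 := by nlinarith
  set N : ℕ := ⌊1 / (4 * (T * lam))⌋₊ with hNd
  have hN1 : (N : ℝ) * (T * lam) ≤ 1 / 4 := by
    have := Nat.floor_le (a := 1 / (4 * (T * lam))) (by positivity)
    rw [← hNd, le_div_iff₀ (by positivity)] at this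
    linarith
  have hN2 : 1 / 8 ≤ (N : ℝ) * (T * lam) := by
    have := Nat.lt_floor_add_one (1 / (4 * (T * lam)))
    rw [← hNd, div_lt_iff₀ (by positivity)] at this
    linarith
  let P : ℕ → Prop := fun k => ∀ x, ‖x - (1 / 2 : ℝ) • eV d‖ ≤ r →
      ∀ t ∈ Icc (-(3 / 4) + k * (T * lam)) (-(3 / 4) + k * (T * lam) + T * lam), 1 / 4 ≤ η (x, t)
  have hA := accumulate hD hg hη (fun p hp => (h01 p hp).1) hT hδ'0 (min_le_left _ _) hδ'T
    (hstep lam Q v η hD hη (fun p hp => (h01 p hp).1)) hN1 P (fun k _ h => h)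
  have hpos' : ∀ p ∈ KcP d 1, 0 ≤ (fun p => 1 - η p) p := fun p hp => by
    have := (h01 p hp).2
    simp only; linarith
  have hB := accumulate hD hg hη' hpos' hT hδ'0 (min_le_left _ _) hδ'T
    (hstep lam Q v _ hD hη' hpos') hN1 (fun k => ¬ P k) (fun k hk h => by
      have hk1 : ((k : ℝ) + 1) ≤ N := by exact_mod_cast hk
      have := mul_le_mul_of_nonneg_right hk1 hTl.le
      have hk0 : (0 : ℝ) ≤ k * (T * lam) := by positivity
      exact (hdich lam Q v η hD hQ hη hη' h01 (-(3 / 4) + k * (T * lam)) (by linarith)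
        (by linarith)).resolve_left h)
  have hsum : (Nat.count P N : ℝ) + (Nat.count (fun k => ¬ P k) N : ℝ) = N := by
    have : ∀ n : ℕ, Nat.count P n + Nat.count (fun k => ¬ P k) n = n := by
      intro n
      induction n with
      | zero => simp
      | succ n ih =>
        rw [Nat.count_succ, Nat.count_succ]
        by_cases h : P n
        · rw [if_pos h, if_neg (not_not.2 h)]; omega
        · rw [if_neg h, if_pos h]; omega
    exact_mod_cast this N
  have key : ∀ c : ℝ, (N : ℝ) / 2 ≤ c →
      min (1 / 2) (δ' * c1 / (16 * T)) ≤ c * (δ' * lam) * c1 := by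
    intro c hc
    refine (min_le_right _ _).trans ?_
    rw [div_le_iff₀ (by positivity)]
    have h1 : 1 / 16 ≤ c * (T * lam) := by
      have := mul_le_mul_of_nonneg_right hc hTl.le
      linarith
    have := mul_le_mul_of_nonneg_left h1 (by positivity : 0 ≤ 16 * (δ' * c1))
    linarith
  rcases le_total ((N : ℝ) / 2) (Nat.count P N : ℝ) with h | h
  · left
    intro p hp
    exact (key _ h).trans (hA p hp)
  · right
    intro p hp
    exact (key _ (by linarith)).trans (hB p hp)

theorem oscillation_decay (d : ℕ) (hd : 1 ≤ d) (Λ M C₀ : ℝ)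
    (hΛ : 1 ≤ Λ) (hM : 1 ≤ M) (hC₀ : 0 < C₀) :
    ∃ μ : ℝ, 0 < μ ∧ μ < 1 ∧
      ∀ (lam : ℝ) (Q Q' : ℝ → Matrix (Fin (d + 1)) (Fin (d + 1)) ℝ)
        (v v' : ℝ → Eucl (d + 1)) (η : SpaceTime (d + 1) → ℝ),
        ObliqueData d lam Λ M C₀ Q Q' v v' →
        ObliqueSolution d lam Q v η →
        (∀ p ∈ KcP d 1, 0 ≤ η p) →
        ∀ m M' : ℝ, (∀ p ∈ KcP d 1, m ≤ η p ∧ η p ≤ M') →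
          ∀ X ∈ KcP d (1 / 2), ∀ Y ∈ KcP d (1 / 2),
            η X - η Y ≤ (1 - μ) * (M' - m) := by
  have hΘ : 0 < Λ * M ^ 2 := by positivity
  obtain ⟨μ, h0, h1, hμ⟩ := exists_mu d (inv_pos.2 hΘ) hΘ hM
  refine ⟨μ, h0, h1, ?_⟩
  intro lam Q Q' v v' η hO hs _ m M' hb X hX Y hY
  have hsub : ∀ p ∈ KcP d (1 / 2), p ∈ KcP d 1 := by
    rintro p (⟨h1, h2, h3⟩ | ⟨h1, h2, h3⟩)
    · exact Or.inl ⟨ball_subset_ball (by norm_num) h1, h2, by linarith [h3.1], h3.2⟩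
    · exact Or.inr ⟨ball_subset_ball (by norm_num) h1, h2, by linarith [h3.1], h3.2⟩
  have hbX := hb X (hsub X hX)
  have hbY := hb Y (hsub Y hY)
  rcases (hbX.1.trans hbX.2).eq_or_lt with hE | hlt
  · rw [← hE] at hbX hbY ⊢
    have := hbX.2
    have := hbY.1
    rw [sub_self, mul_zero]; linarith
  have hD : Dat d lam (Λ * M ^ 2)⁻¹ (Λ * M ^ 2) M Q v :=
    ⟨hO.lam_pos, hO.lam_le_one, fun t ht => hO.ell ht, hO.vbound, hO.vlast⟩
  have hQ : ContinuousOn Q (Icc (-1) 0) := by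
    refine continuousOn_pi.2 fun i => continuousOn_pi.2 fun j => ?_
    exact fun t ht => (hO.Qderiv t ht i j).continuousWithinAt
  have hL : 0 < M' - m := by linarith
  have ha : 0 < (M' - m)⁻¹ := inv_pos.2 hL
  set a := (M' - m)⁻¹ with had
  have haL : a * (M' - m) = 1 := inv_mul_cancel₀ hL.ne'
  have hS := supA hs.2 ha (-(a * m))
  have hS' : ObliqueSup d lam Q v (fun p => 1 - (a * η p + -(a * m))) := by
    have := subA hs.1 ha (1 + a * m)
    convert this using 2
    ring
  have h01 : ∀ p ∈ KcP d 1, 0 ≤ (fun p => a * η p + -(a * m)) p ∧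
      (fun p => a * η p + -(a * m)) p ≤ 1 := by
    intro p hp
    have h1 := mul_le_mul_of_nonneg_left (hb p hp).1 ha.le
    have h2 := mul_le_mul_of_nonneg_left (hb p hp).2 ha.le
    constructor
    · simp only; linarith
    · simp only; linarith
  have fin : μ * (M' - m) ≤ M' - m - (η X - η Y) := by
    rcases hμ lam Q v _ hD hQ hS hS' h01 with h | h
    · have := mul_le_mul_of_nonneg_right (h Y hY) hL.le
      have e : (a * η Y + -(a * m)) * (M' - m) = (η Y - m) * (a * (M' - m)) := by ring
      rw [e, haL] at this
      linarith [hbX.2]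
    · have := mul_le_mul_of_nonneg_right (h X hX) hL.le
      have e : (1 - (a * η X + -(a * m))) * (M' - m)
        = (M' - m) - (η X - m) * (a * (M' - m)) := by ring
      rw [e, haL] at this
      linarith [hbY.1]
  linarith
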